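/- There exist absolute constants C > 0 and γ₀ > 0 such that for every γ > γ₀ and every unidirectional Stokes wave solution (ψ, η, r) with R(s_c) < r ≤ R(0), one has for every x ∈ ℝ the chain of inequalities ψ_y(x, η(x)) ≥ γ·η̌ − C·γ⁻² and γ·η̌ − C·γ⁻² ≥ √(2γ) − C·γ⁻¹; in particular ψ_y ≥ √(2γ) − C·γ⁻¹ everywhere on the free surface. -/

import Mathlib

noncomputable section

open Real Set

/-- Partial derivative of `ψ` in the horizontal variable. -/
def px (ψ : ℝ → ℝ → ℝ) (x y : ℝ) : ℝ := deriv (fun t => ψ t y) x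

/-- Partial derivative of `ψ` in the vertical variable. -/
def py (ψ : ℝ → ℝ → ℝ) (x y : ℝ) : ℝ := deriv (fun t => ψ x t) y

/-- Second partial derivative in `x`. -/
def pxx (ψ : ℝ → ℝ → ℝ) (x y : ℝ) : ℝ := deriv (fun t => px ψ t y) x

/-- Second partial derivative in `y`. -/
def pyy (ψ : ℝ → ℝ → ℝ) (x y : ℝ) : ℝ := deriv (fun t => py ψ x t) y

/-- Depth `d(s)` of the laminar (stream) flow with surface value `s` of `ψ_y`. -/
def lamDepth (γ s : ℝ) : ℝ := (-s + Real.sqrt (s ^ 2 + 2 * γ)) / γ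

/-- Bernoulli constant `R(s) = ½ s² + γ + d(s)` of the laminar flow. -/
def bernR (γ s : ℝ) : ℝ := s ^ 2 / 2 + γ + lamDepth γ s

/-- `s` is the (unique) positive critical point `s_c` of `R`, characterized by the
equation `s - 1/γ + s/(γ √(s² + 2γ)) = 0`. -/
def IsCrit (γ s : ℝ) : Prop :=
  0 < s ∧ s - 1 / γ + s / (γ * Real.sqrt (s ^ 2 + 2 * γ)) = 0

/-- A solution `(ψ, η, r)` of the stream-function formulation with constant adverse
vorticity `ω = -γ`:  `Δψ = γ` in the fluid domain `D_η`, the Bernoulli condition on the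
surface, `ψ = 1` on the surface and `ψ = 0` on the flat bottom. -/
structure StreamSolution (γ : ℝ) (ψ : ℝ → ℝ → ℝ) (η : ℝ → ℝ) (r : ℝ) : Prop where
  eta_smooth : ContDiff ℝ (⊤ : ℕ∞) η
  eta_pos : ∀ x, 0 < η x
  psi_smooth : ContDiff ℝ (⊤ : ℕ∞) (fun p : ℝ × ℝ => ψ p.1 p.2)
  laplace : ∀ x y, 0 < y → y < η x → pxx ψ x y + pyy ψ x y = γ
  bernoulli : ∀ x, (px ψ x (η x)) ^ 2 / 2 + (py ψ x (η x)) ^ 2 / 2 + η x = r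
  surface_val : ∀ x, ψ x (η x) = 1
  bottom_val : ∀ x, ψ x 0 = 0

/-- The flow is unidirectional: `ψ_y > 0` everywhere in the fluid domain `D_η`. -/
def Unidirectional (ψ : ℝ → ℝ → ℝ) (η : ℝ → ℝ) : Prop :=
  ∀ x y, 0 < y → y < η x → 0 < py ψ x y

/-- A Stokes wave with half-period `Λ`: the solution is `2Λ`-periodic and even in `x`,
and the surface profile is strictly decreasing from the crest (`x = 0`) to the
trough (`x = Λ`).  Thus `η̂ = max η = η 0` and `η̌ = min η = η Λ`. -/
structure StokesWave (γ : ℝ) (ψ : ℝ → ℝ → ℝ) (η : ℝ → ℝ) (r Λ : ℝ) : Prop where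
  sol : StreamSolution γ ψ η r
  lam_pos : 0 < Λ
  eta_periodic : ∀ x, η (x + 2 * Λ) = η x
  eta_even : ∀ x, η (-x) = η x
  psi_periodic : ∀ x y, ψ (x + 2 * Λ) y = ψ x y
  psi_even : ∀ x y, ψ (-x) y = ψ x y
  eta_anti : StrictAntiOn η (Set.Icc 0 Λ)

/-- A solitary wave (relative to the critical value `sc = s_c` of `γ`): the solution is
even in `x`, the profile is strictly decreasing on `(0, ∞)` and non-constant, and the
flow converges to a supercritical laminar flow `(U(·; s), d(s))` with `s > s_c`,
`R(s) = r` as `|x| → ∞`.  The crest is at `x = 0`, `η̂ = η 0` and `η̌ = inf η = d(s)`. -/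
structure SolitaryWave (γ sc : ℝ) (ψ : ℝ → ℝ → ℝ) (η : ℝ → ℝ) (r : ℝ) : Prop where
  sol : StreamSolution γ ψ η r
  eta_even : ∀ x, η (-x) = η x
  psi_even : ∀ x y, ψ (-x) y = ψ x y
  eta_anti : StrictAntiOn η (Set.Ioi 0)
  nonconst : ∃ x₁ x₂, η x₁ ≠ η x₂
  asymptotic : ∃ s, sc < s ∧ bernR γ s = r ∧
    ∀ ε > 0, ∃ X : ℝ, ∀ x : ℝ, X ≤ |x| →
      |η x - lamDepth γ s| ≤ ε ∧
      ∀ y ∈ Set.Icc 0 (η x), |px ψ x y| + |py ψ x y - (γ * y + s)| ≤ ε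

/-! ### Calculus layer: partial derivatives of smooth functions on the plane -/

/-- Horizontal partial derivative. -/
def DX (u : ℝ × ℝ → ℝ) (p : ℝ × ℝ) : ℝ := fderiv ℝ u p (1, 0)

/-- Vertical partial derivative. -/
def DY (u : ℝ × ℝ → ℝ) (p : ℝ × ℝ) : ℝ := fderiv ℝ u p (0, 1)

/-- Smooth functions on the plane. -/
def Sm (u : ℝ × ℝ → ℝ) : Prop := ContDiff ℝ (⊤ : ℕ∞) u

lemma Sm.dx {u : ℝ × ℝ → ℝ} (h : Sm u) : Sm (DX u) := by
  unfold Sm DX at *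
  have : ContDiff ℝ (⊤ : ℕ∞) (fderiv ℝ u) := h.fderiv_right (by norm_cast)
  exact this.clm_apply contDiff_const

lemma Sm.dy {u : ℝ × ℝ → ℝ} (h : Sm u) : Sm (DY u) := by
  unfold Sm DY at *
  have : ContDiff ℝ (⊤ : ℕ∞) (fderiv ℝ u) := h.fderiv_right (by norm_cast)
  exact this.clm_apply contDiff_const

lemma Sm.diff {u : ℝ × ℝ → ℝ} (h : Sm u) : Differentiable ℝ u :=
  ContDiff.differentiable h (by norm_num)

lemma Sm.cont {u : ℝ × ℝ → ℝ} (h : Sm u) : Continuous u := h.diff.continuous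

lemma Sm.hx {u : ℝ × ℝ → ℝ} (h : Sm u) (x y : ℝ) :
    HasDerivAt (fun t => u (t, y)) (DX u (x, y)) x := by
  have h1 : HasFDerivAt u (fderiv ℝ u (x, y)) (x, y) := (h.diff (x, y)).hasFDerivAt
  have h2 : HasDerivAt (fun t : ℝ => (t, y)) ((1 : ℝ), (0 : ℝ)) x :=
    (hasDerivAt_id x).prodMk (hasDerivAt_const x y)
  exact h1.comp_hasDerivAt x h2

lemma Sm.hy {u : ℝ × ℝ → ℝ} (h : Sm u) (x y : ℝ) :
    HasDerivAt (fun t => u (x, t)) (DY u (x, y)) y := by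
  have h1 : HasFDerivAt u (fderiv ℝ u (x, y)) (x, y) := (h.diff (x, y)).hasFDerivAt
  have h2 : HasDerivAt (fun t : ℝ => (x, t)) ((0 : ℝ), (1 : ℝ)) y :=
    (hasDerivAt_const y x).prodMk (hasDerivAt_id y)
  exact h1.comp_hasDerivAt y h2

lemma Sm.hcurve {u : ℝ × ℝ → ℝ} (h : Sm u) {e : ℝ → ℝ} {e' x : ℝ} (he : HasDerivAt e e' x) :
    HasDerivAt (fun t => u (t, e t)) (DX u (x, e x) + e' * DY u (x, e x)) x := by
  have h1 : HasFDerivAt u (fderiv ℝ u (x, e x)) (x, e x) := (h.diff (x, e x)).hasFDerivAt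
  have h2 : HasDerivAt (fun t : ℝ => (t, e t)) ((1 : ℝ), e') x :=
    (hasDerivAt_id x).prodMk he
  have h3 := h1.comp_hasDerivAt x h2
  have e1 : ((1 : ℝ), e') = (1, 0) + e' • ((0 : ℝ), (1 : ℝ)) := by simp
  have e2 : fderiv ℝ u (x, e x) (1, e') = DX u (x, e x) + e' * DY u (x, e x) := by
    rw [e1, map_add, map_smul]
    rfl
  rw [e2] at h3
  exact h3

lemma Sm.comm {u : ℝ × ℝ → ℝ} (h : Sm u) : DY (DX u) = DX (DY u) := by
  funext p
  have hs : IsSymmSndFDerivAt ℝ u p :=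
    (ContDiff.contDiffAt h).isSymmSndFDerivAt (by simp; norm_cast)
  have hd : ContDiff ℝ (⊤ : ℕ∞) (fderiv ℝ u) := ContDiff.fderiv_right h (by norm_cast)
  have hd' : DifferentiableAt ℝ (fderiv ℝ u) p := (hd.differentiable (by norm_num)) p
  have e := hs (0, 1) (1, 0)
  unfold DY DX
  have e1 : ∀ v : ℝ × ℝ, fderiv ℝ (fun q => fderiv ℝ u q v) p = (fderiv ℝ (fderiv ℝ u) p).flip v := by
    intro v
    rw [fderiv_clm_apply hd' (differentiableAt_const v)]
    simp
  rw [e1, e1]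
  simpa using e

lemma dx_eq {u : ℝ × ℝ → ℝ} (h : Sm u) {x y a : ℝ}
    (h1 : HasDerivAt (fun t => u (t, y)) a x) : DX u (x, y) = a := (h.hx x y).unique h1

lemma dy_eq {u : ℝ × ℝ → ℝ} (h : Sm u) {x y a : ℝ}
    (h1 : HasDerivAt (fun t => u (x, t)) a y) : DY u (x, y) = a := (h.hy x y).unique h1

/-- Second order necessary condition for a local maximum on the line. -/
lemma second_test {h h' : ℝ → ℝ} {a x : ℝ} (hm : IsLocalMax h x)
    (h1 : ∀ t, HasDerivAt h (h' t) t) (h2 : HasDerivAt h' a x) : h' x = 0 ∧ a ≤ 0 := by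
  have e0 : h' x = 0 := hm.hasDerivAt_eq_zero (h1 x)
  refine ⟨e0, ?_⟩
  by_contra hc
  push Not at hc
  have hd : deriv h = h' := funext fun t => (h1 t).deriv
  have hmin : IsLocalMin h x := isLocalMin_of_deriv_deriv_pos
    (by rw [hd, h2.deriv]; exact hc) (by rw [hd, e0]) (h1 x).continuousAt
  -- then h is locally constant
  have hconst : ∀ᶠ t in nhds x, h t = h x := by
    filter_upwards [hm, hmin] with t ht1 ht2 using le_antisymm ht1 ht2
  have hd0 : ∀ᶠ t in nhds x, h' t = 0 := by
    filter_upwards [hconst.eventually_nhds] with t ht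
    have : h =ᶠ[nhds t] fun _ => h x := ht
    have h3 := (h1 t).congr_of_eventuallyEq this.symm
    exact h3.unique (hasDerivAt_const t (h x))
  have h4 : h' =ᶠ[nhds x] fun _ => (0 : ℝ) := hd0
  have h5 := h2.congr_of_eventuallyEq h4.symm
  have := h5.unique (hasDerivAt_const x (0 : ℝ))
  linarith

/-- A smooth function with a local maximum. -/
lemma Sm.localMax {u : ℝ × ℝ → ℝ} (h : Sm u) {x y : ℝ} (hm : IsLocalMax u (x, y)) :
    DX u (x, y) = 0 ∧ DY u (x, y) = 0 ∧ DX (DX u) (x, y) ≤ 0 ∧ DY (DY u) (x, y) ≤ 0 := by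
  have m1 : IsLocalMax (fun t => u (t, y)) x := by
    have : ContinuousAt (fun t : ℝ => (t, y)) x := by fun_prop
    exact this.eventually hm
  have m2 : IsLocalMax (fun t => u (x, t)) y := by
    have : ContinuousAt (fun t : ℝ => (x, t)) y := by fun_prop
    exact this.eventually hm
  have t1 := second_test m1 (fun t => h.hx t y) (h.dx.hx x y)
  have t2 := second_test m2 (fun t => h.hy x t) (h.dy.hy x y)
  exact ⟨t1.1, t2.1, t1.2, t2.2⟩

/-- One sided derivative test: maximum at the right end of an interval. -/
lemma deriv_nonneg_of_max_left {h : ℝ → ℝ} {a x l : ℝ} (hl : l < x) (hd : HasDerivAt h a x)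
    (hm : ∀ t, l < t → t < x → h t ≤ h x) : 0 ≤ a := by
  by_contra hc
  push Not at hc
  have h1 := hd.hasDerivWithinAt (s := Set.Iio x)
  have h2 := hasDerivWithinAt_iff_tendsto_slope.1 h1
  have h3 : Set.Iio x \ {x} = Set.Iio x := by simp
  rw [h3] at h2
  have h4 : ∀ᶠ t in nhdsWithin x (Set.Iio x), slope h x t < 0 := h2.eventually (gt_mem_nhds hc)
  have h5 : ∀ᶠ t in nhdsWithin x (Set.Iio x), t ∈ Set.Ioo l x := Ioo_mem_nhdsLT hl
  obtain ⟨t, ht1, ht2⟩ := (h4.and h5).exists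
  have := hm t ht2.1 ht2.2
  rw [slope_def_field] at ht1
  have h6 : 0 ≤ (h t - h x) / (t - x) := div_nonneg_of_nonpos (by linarith) (by linarith [ht2.2])
  linarith

/-- One sided derivative test: maximum at the left end of an interval. -/
lemma deriv_nonpos_of_max_right {h : ℝ → ℝ} {a x l : ℝ} (hl : x < l) (hd : HasDerivAt h a x)
    (hm : ∀ t, x < t → t < l → h t ≤ h x) : a ≤ 0 := by
  have h1 : HasDerivAt (fun t => h (-t)) (-a) (-x) := by
    have h2 : HasDerivAt h a (-(-x)) := by simpa using hd
    have := h2.scomp (-x) (hasDerivAt_neg (-x))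
    simpa [Function.comp_def] using this
  have := deriv_nonneg_of_max_left (l := -l) (by linarith) h1 (fun t h3 h4 => by
    have := hm (-t) (by linarith) (by linarith)
    simpa using this)
  linarith

/-! ### The rescaled problem -/

/-- Rescaled Stokes wave: unit vorticity, gravity `ε`. -/
structure SWave (ε r Λ : ℝ) (u : ℝ × ℝ → ℝ) (η : ℝ → ℝ) : Prop where
  eps_pos : 0 < ε
  r_le : r ≤ 1 + √2 * ε
  le_r : 1 + √2 * ε - ε ^ 2 ≤ r
  lam_pos : 0 < Λ
  su : Sm u
  se : ContDiff ℝ (⊤ : ℕ∞) η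
  pos : ∀ x, 0 < η x
  lap : ∀ x y, 0 < y → y < η x → DX (DX u) (x, y) + DY (DY u) (x, y) = 1
  bern : ∀ x, DX u (x, η x) ^ 2 + DY u (x, η x) ^ 2 = 2 * (r - ε * η x)
  top : ∀ x, u (x, η x) = 1
  bot : ∀ x, u (x, 0) = 0
  eper : ∀ x, η (x + 2 * Λ) = η x
  eeven : ∀ x, η (-x) = η x
  uper : ∀ x y, u (x + 2 * Λ, y) = u (x, y)
  ueven : ∀ x y, u (-x, y) = u (x, y)
  anti : StrictAntiOn η (Set.Icc 0 Λ)
  uni : ∀ x y, 0 < y → y < η x → 0 < DY u (x, y)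

namespace SWave

variable {ε r Λ : ℝ} {u : ℝ × ℝ → ℝ} {η : ℝ → ℝ}

lemma ec (h : SWave ε r Λ u η) : Continuous η := h.se.continuous

lemma ed (h : SWave ε r Λ u η) (x : ℝ) : HasDerivAt η (deriv η x) x :=
  ((h.se.differentiable (by norm_num)) x).hasDerivAt

lemma closure_ext {f : ℝ → ℝ} (hf : Continuous f) {b : ℝ} (hb : 0 < b)
    {s : Set ℝ} (hs : IsClosed s) (h : ∀ t, 0 < t → t < b → f t ∈ s) {y : ℝ} (h0 : 0 ≤ y)
    (h1 : y ≤ b) : f y ∈ s := by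
  have h2 : y ∈ closure (Set.Ioo 0 b) := by
    rw [closure_Ioo hb.ne]; exact ⟨h0, h1⟩
  have h3 : Set.Ioo 0 b ⊆ f ⁻¹' s := fun t ht => h t ht.1 ht.2
  exact (closure_minimal h3 (hs.preimage hf)) h2

lemma lapc (h : SWave ε r Λ u η) (x y : ℝ) (h0 : 0 ≤ y) (h1 : y ≤ η x) :
    DX (DX u) (x, y) + DY (DY u) (x, y) = 1 := by
  have c1 := h.su.dx.dx.cont
  have c2 := h.su.dy.dy.cont
  exact closure_ext (f := fun y => DX (DX u) (x, y) + DY (DY u) (x, y)) (by fun_prop) (h.pos x)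
    (isClosed_singleton (x := (1 : ℝ))) (fun t a b => h.lap x t a b) h0 h1

lemma unic (h : SWave ε r Λ u η) (x y : ℝ) (h0 : 0 ≤ y) (h1 : y ≤ η x) :
    0 ≤ DY u (x, y) := by
  have c1 := h.su.dy.cont
  exact closure_ext (f := fun y => DY u (x, y)) (by fun_prop) (h.pos x)
    (isClosed_Ici (a := (0 : ℝ))) (fun t a b => (h.uni x t a b).le) h0 h1

lemma open_dom (h : SWave ε r Λ u η) {x y : ℝ} (h0 : 0 < y) (h1 : y < η x) :
    ∀ᶠ p : ℝ × ℝ in nhds (x, y), 0 < p.2 ∧ p.2 < η p.1 := by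
  have c := h.ec
  have o : IsOpen {p : ℝ × ℝ | 0 < p.2 ∧ p.2 < η p.1} :=
    (isOpen_lt continuous_const continuous_snd).inter
      (isOpen_lt continuous_snd (c.comp continuous_fst))
  exact o.mem_nhds ⟨h0, h1⟩

lemma lap3 (h : SWave ε r Λ u η) (x y : ℝ) (h0 : 0 < y) (h1 : y < η x) :
    DX (DX (DX u)) (x, y) + DX (DY (DY u)) (x, y) = 0 ∧
    DY (DX (DX u)) (x, y) + DY (DY (DY u)) (x, y) = 0 := by
  have ev := h.open_dom h0 h1
  have cx : ContinuousAt (fun t : ℝ => (t, y)) x := by fun_prop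
  have cy : ContinuousAt (fun t : ℝ => (x, t)) y := by fun_prop
  constructor
  · have d := (h.su.dx.dx.hx x y).add (h.su.dy.dy.hx x y)
    refine d.unique ?_
    refine (hasDerivAt_const x (1 : ℝ)).congr_of_eventuallyEq ?_
    filter_upwards [cx.eventually ev] with t ht using h.lap t y ht.1 ht.2
  · have d := (h.su.dx.dx.hy x y).add (h.su.dy.dy.hy x y)
    refine d.unique ?_
    refine (hasDerivAt_const y (1 : ℝ)).congr_of_eventuallyEq ?_
    filter_upwards [cy.eventually ev] with t ht using h.lap x t ht.1 ht.2

/-- Reduction of the horizontal variable to one half period. -/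
lemma reduce (h : SWave ε r Λ u η) (x : ℝ) :
    ∃ x' ∈ Set.Icc 0 Λ, η x' = η x := by
  have hp : Function.Periodic η (2 * Λ) := h.eper
  have hl : (0 : ℝ) < 2 * Λ := by linarith [h.lam_pos]
  obtain ⟨y, hy, e⟩ := hp.exists_mem_Ico₀ hl x
  by_cases hc : y ≤ Λ
  · exact ⟨y, ⟨hy.1, hc⟩, e.symm⟩
  · push Not at hc
    refine ⟨2 * Λ - y, ⟨by linarith [hy.2], by linarith⟩, ?_⟩
    rw [e, ← h.eeven y, ← h.eper (-y)]
    congr 1; ring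

lemma eta_ge (h : SWave ε r Λ u η) (x : ℝ) : η Λ ≤ η x := by
  obtain ⟨x', hx', e⟩ := h.reduce x
  rw [← e]
  exact h.anti.antitoneOn hx' ⟨h.lam_pos.le, le_refl _⟩ hx'.2

lemma eta_le (h : SWave ε r Λ u η) (x : ℝ) : η x ≤ η 0 := by
  obtain ⟨x', hx', e⟩ := h.reduce x
  rw [← e]
  exact h.anti.antitoneOn ⟨le_refl _, h.lam_pos.le⟩ hx' hx'.1

/-- Periodic functions attain their maximum over periodic closed subsets of the strip. -/
lemma attain (h : SWave ε r Λ u η) {S : Set (ℝ × ℝ)} (hS : IsClosed S)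
    (hsub : ∀ p ∈ S, 0 ≤ p.2 ∧ p.2 ≤ η p.1) (hne : S.Nonempty)
    (hper : ∀ x y, (x + 2 * Λ, y) ∈ S ↔ (x, y) ∈ S) {g : ℝ × ℝ → ℝ} (hg : Continuous g)
    (gper : ∀ x y, g (x + 2 * Λ, y) = g (x, y)) : ∃ p ∈ S, ∀ q ∈ S, g q ≤ g p := by
  have hl : (0 : ℝ) < 2 * Λ := by linarith [h.lam_pos]
  have red : ∀ x y, (x, y) ∈ S → ∃ x' ∈ Set.Icc 0 (2 * Λ), (x', y) ∈ S ∧ g (x', y) = g (x, y) := by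
    intro x y hxy
    have hp : Function.Periodic (fun t => (((t, y) ∈ S), g (t, y))) (2 * Λ) := by
      intro t
      simp only [Prod.mk.injEq]
      exact ⟨propext (hper t y), gper t y⟩
    obtain ⟨x', hx', e⟩ := hp.exists_mem_Ico₀ hl x
    simp only [Prod.mk.injEq] at e
    exact ⟨x', Set.Ico_subset_Icc_self hx', e.1 ▸ hxy, e.2.symm⟩
  have hK : IsCompact (S ∩ (Set.Icc 0 (2 * Λ) ×ˢ Set.Icc 0 (η 0))) :=
    (isCompact_Icc.prod isCompact_Icc).inter_left hS
  have hKne : (S ∩ (Set.Icc 0 (2 * Λ) ×ˢ Set.Icc 0 (η 0))).Nonempty := by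
    obtain ⟨⟨x, y⟩, hxy⟩ := hne
    obtain ⟨x', hx', h1, -⟩ := red x y hxy
    exact ⟨(x', y), h1, hx', (hsub _ h1).1, (hsub _ h1).2.trans (h.eta_le _)⟩
  obtain ⟨p, hp, hmax⟩ := hK.exists_isMaxOn hKne hg.continuousOn
  refine ⟨p, hp.1, ?_⟩
  rintro ⟨x, y⟩ hxy
  obtain ⟨x', hx', h1, e⟩ := red x y hxy
  rw [← e]
  exact hmax ⟨h1, hx', (hsub _ h1).1, (hsub _ h1).2.trans (h.eta_le _)⟩

lemma isClosed_dom (h : SWave ε r Λ u η) : IsClosed {p : ℝ × ℝ | 0 ≤ p.2 ∧ p.2 ≤ η p.1} :=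
  (isClosed_le continuous_const continuous_snd).inter
    (isClosed_le continuous_snd (h.ec.comp continuous_fst))

lemma attain_dom (h : SWave ε r Λ u η) {g : ℝ × ℝ → ℝ} (hg : Continuous g)
    (gper : ∀ x y, g (x + 2 * Λ, y) = g (x, y)) :
    ∃ x y, 0 ≤ y ∧ y ≤ η x ∧ ∀ x' y', 0 ≤ y' → y' ≤ η x' → g (x', y') ≤ g (x, y) := by
  obtain ⟨⟨x, y⟩, hp, hm⟩ := h.attain h.isClosed_dom (fun p hp => hp)
    ⟨(0, 0), le_refl _, (h.pos 0).le⟩ (fun x y => by simp [h.eper]) hg gper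
  exact ⟨x, y, hp.1, hp.2, fun x' y' a b => hm (x', y') ⟨a, b⟩⟩

lemma per_dx (h : SWave ε r Λ u η) (x y : ℝ) : DX u (x + 2 * Λ, y) = DX u (x, y) := by
  symm
  refine dx_eq h.su ?_
  have h1 := (h.su.hx (x + 2 * Λ) y).comp_add_const x (2 * Λ)
  refine h1.congr_of_eventuallyEq (Filter.Eventually.of_forall fun t => ?_)
  exact (h.uper t y).symm

lemma per_dy (h : SWave ε r Λ u η) (x y : ℝ) : DY u (x + 2 * Λ, y) = DY u (x, y) := by
  symm
  refine dy_eq h.su ?_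
  refine (h.su.hy (x + 2 * Λ) y).congr_of_eventuallyEq (Filter.Eventually.of_forall fun t => ?_)
  exact (h.uper x t).symm

lemma even_dx (h : SWave ε r Λ u η) (x y : ℝ) : DX u (-x, y) = - DX u (x, y) := by
  have h1 := (h.su.hx (-x) y).scomp x (hasDerivAt_neg x)
  have h2 : DX u (x, y) = (-1 : ℝ) • DX u (-x, y) := by
    refine dx_eq h.su ?_
    refine h1.congr_of_eventuallyEq (Filter.Eventually.of_forall fun t => ?_)
    exact (h.ueven t y).symm
  simp at h2
  linarith

lemma even_dy (h : SWave ε r Λ u η) (x y : ℝ) : DY u (-x, y) = DY u (x, y) := by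
  symm
  refine dy_eq h.su ?_
  refine (h.su.hy (-x) y).congr_of_eventuallyEq (Filter.Eventually.of_forall fun t => ?_)
  exact (h.ueven x t).symm

lemma bot_dx (h : SWave ε r Λ u η) (x : ℝ) : DX u (x, 0) = 0 := by
  refine dx_eq h.su ?_
  refine (hasDerivAt_const x (0 : ℝ)).congr_of_eventuallyEq
    (Filter.Eventually.of_forall fun t => h.bot t)

lemma bot_dxx (h : SWave ε r Λ u η) (x : ℝ) : DX (DX u) (x, 0) = 0 := by
  refine dx_eq h.su.dx ?_
  refine (hasDerivAt_const x (0 : ℝ)).congr_of_eventuallyEq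
    (Filter.Eventually.of_forall fun t => h.bot_dx t)

lemma top_dx (h : SWave ε r Λ u η) (x : ℝ) :
    DX u (x, η x) = - deriv η x * DY u (x, η x) := by
  have h1 := h.su.hcurve (h.ed x)
  have h2 : HasDerivAt (fun t => u (t, η t)) 0 x :=
    (hasDerivAt_const x (1 : ℝ)).congr_of_eventuallyEq
      (Filter.Eventually.of_forall fun t => h.top t)
  have := h1.unique h2
  linarith

lemma u_mono (h : SWave ε r Λ u η) {x y y' : ℝ} (h0 : 0 ≤ y) (h1 : y ≤ y') (h2 : y' ≤ η x) :
    u (x, y) ≤ u (x, y') := by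
  have c := h.su.cont
  have hm : MonotoneOn (fun t => u (x, t)) (Set.Icc 0 (η x)) := by
    refine monotoneOn_of_deriv_nonneg (convex_Icc _ _) (by fun_prop)
      (fun t _ => (h.su.hy x t).differentiableAt.differentiableWithinAt) ?_
    intro t ht
    rw [interior_Icc] at ht
    rw [(h.su.hy x t).deriv]
    exact (h.uni x t ht.1 ht.2).le
  exact hm ⟨h0, h1.trans h2⟩ ⟨h0.trans h1, h2⟩ h1

lemma u_nonneg (h : SWave ε r Λ u η) {x y : ℝ} (h0 : 0 ≤ y) (h2 : y ≤ η x) : 0 ≤ u (x, y) := by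
  have := h.u_mono (le_refl 0) h0 h2
  rwa [h.bot] at this

lemma u_le_one (h : SWave ε r Λ u η) {x y : ℝ} (h0 : 0 ≤ y) (h2 : y ≤ η x) : u (x, y) ≤ 1 := by
  have := h.u_mono h0 h2 (le_refl _)
  rwa [h.top] at this

end SWave

/-! ### The P-function `|∇u|² - 2u` -/
namespace SWave

variable {ε r Λ : ℝ} {u : ℝ × ℝ → ℝ} {η : ℝ → ℝ}

/-- The P-function. -/
def PF (u : ℝ × ℝ → ℝ) (p : ℝ × ℝ) : ℝ := DX u p ^ 2 + DY u p ^ 2 - 2 * u p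

lemma PF_crit (h : SWave ε r Λ u η) {σ : ℝ} (hσ : σ ^ 2 = 1) {f f' f'' : ℝ → ℝ}
    (hf : ∀ t, HasDerivAt f (f' t) t) (hf' : ∀ t, HasDerivAt f' (f'' t) t) {x y : ℝ}
    (h0 : 0 < y) (h1 : y < η x)
    (hm : IsLocalMax (fun p => σ * PF u p + f (u p)) (x, y)) :
    σ * f' (u (x, y)) ^ 2 - f' (u (x, y)) +
      f'' (u (x, y)) * (DX u (x, y) ^ 2 + DY u (x, y) ^ 2) ≤ 0 := by
  have m1 : IsLocalMax (fun t => σ * PF u (t, y) + f (u (t, y))) x := by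
    have : ContinuousAt (fun t : ℝ => (t, y)) x := by fun_prop
    exact this.eventually hm
  have m2 : IsLocalMax (fun t => σ * PF u (x, t) + f (u (x, t))) y := by
    have : ContinuousAt (fun t : ℝ => (x, t)) y := by fun_prop
    exact this.eventually hm
  have s := h.su
  have d1 : ∀ t, HasDerivAt (fun t => σ * PF u (t, y) + f (u (t, y)))
      (σ * (2 * DX u (t, y) * DX (DX u) (t, y) + 2 * DY u (t, y) * DX (DY u) (t, y)
        - 2 * DX u (t, y)) + f' (u (t, y)) * DX u (t, y)) t := by
    intro t
    have := (((((s.dx.hx t y).pow 2).add ((s.dy.hx t y).pow 2)).sub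
      ((s.hx t y).const_mul 2)).const_mul σ).add ((hf (u (t, y))).comp t (s.hx t y))
    refine this.congr_deriv ?_
    norm_num
  have d2 : ∀ t, HasDerivAt (fun t => σ * PF u (x, t) + f (u (x, t)))
      (σ * (2 * DX u (x, t) * DY (DX u) (x, t) + 2 * DY u (x, t) * DY (DY u) (x, t)
        - 2 * DY u (x, t)) + f' (u (x, t)) * DY u (x, t)) t := by
    intro t
    have := (((((s.dx.hy x t).pow 2).add ((s.dy.hy x t).pow 2)).sub
      ((s.hy x t).const_mul 2)).const_mul σ).add ((hf (u (x, t))).comp t (s.hy x t))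
    refine this.congr_deriv ?_
    norm_num
  have e1 := ((((((s.dx.hx x y).const_mul 2).mul (s.dx.dx.hx x y)).add
    (((s.dy.hx x y).const_mul 2).mul (s.dy.dx.hx x y))).sub
      ((s.dx.hx x y).const_mul 2)).const_mul σ).add
        (((hf' (u (x, y))).comp x (s.hx x y)).mul (s.dx.hx x y))
  have e2 := ((((((s.dx.hy x y).const_mul 2).mul (s.dx.dy.hy x y)).add
    (((s.dy.hy x y).const_mul 2).mul (s.dy.dy.hy x y))).sub
      ((s.dy.hy x y).const_mul 2)).const_mul σ).add
        (((hf' (u (x, y))).comp y (s.hy x y)).mul (s.dy.hy x y))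
  obtain ⟨a1, b1⟩ := second_test m1 d1 e1
  obtain ⟨a2, b2⟩ := second_test m2 d2 e2
  obtain ⟨t1, t2⟩ := h.lap3 x y h0 h1
  have t0 := h.lap x y h0 h1
  have pos := h.uni x y h0 h1
  have c1 : DY (DX u) (x, y) = DX (DY u) (x, y) := by rw [s.comm]
  have c2 : DY (DY (DX u)) (x, y) = DX (DY (DY u)) (x, y) := by rw [s.comm, s.dy.comm]
  have c3 : DY (DX (DX u)) (x, y) = DX (DX (DY u)) (x, y) := by rw [s.dx.comm, s.comm]
  simp only [Function.comp_apply] at b1 b2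
  rw [c1] at a2 b2
  rw [c2] at b2
  rw [c3] at t2
  generalize DX (DX (DX u)) (x, y) = α at *
  generalize DX (DX (DY u)) (x, y) = β at *
  generalize DX (DY (DY u)) (x, y) = α' at *
  generalize DY (DY (DY u)) (x, y) = β' at *
  generalize DX (DX u) (x, y) = A at *
  generalize DX (DY u) (x, y) = B at *
  generalize DY (DY u) (x, y) = C at *
  generalize DX u (x, y) = a at *
  generalize DY u (x, y) = b at *
  generalize f' (u (x, y)) = k at *
  generalize f'' (u (x, y)) = l at *
  have hα : α' = -α := by linarith
  have hβ : β' = -β := by linarith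
  have hC : C = 1 - A := by linarith
  subst hα hβ hC
  have g : 0 < a ^ 2 + b ^ 2 := by positivity
  -- second order sum
  have S : σ * (2 * A ^ 2 + 4 * B ^ 2 + 2 * (1 - A) ^ 2 - 2) + l * (a ^ 2 + b ^ 2) + k ≤ 0 := by
    nlinarith [b1, b2]
  -- gradient identities
  have key : (a ^ 2 + b ^ 2) * (2 * A ^ 2 + 4 * B ^ 2 + 2 * (1 - A) ^ 2 - 2) =
      (a ^ 2 + b ^ 2) * (k ^ 2 - 2 * σ * k) := by
    have p1 : 2 * a * A + 2 * b * B - 2 * a = - σ * k * a := by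
      have : σ * (σ * (2 * a * A + 2 * b * B - 2 * a) + k * a) = 0 := by rw [a1]; ring
      linear_combination this - (2 * a * A + 2 * b * B - 2 * a) * hσ
    have p2 : 2 * a * B + 2 * b * (1 - A) - 2 * b = - σ * k * b := by
      have : σ * (σ * (2 * a * B + 2 * b * (1 - A) - 2 * b) + k * b) = 0 := by rw [a2]; ring
      linear_combination this - (2 * a * B + 2 * b * (1 - A) - 2 * b) * hσ
    have id : (a ^ 2 + b ^ 2) * (2 * A ^ 2 + 4 * B ^ 2 + 2 * (1 - A) ^ 2 - 2) =
        (2 * a * A + 2 * b * B - 2 * a) ^ 2 + (2 * a * B + 2 * b * (1 - A) - 2 * b) ^ 2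
        + 2 * ((2 * a * A + 2 * b * B - 2 * a) * a + (2 * a * B + 2 * b * (1 - A) - 2 * b) * b) := by
      ring
    rw [id, p1, p2]
    linear_combination (a ^ 2 + b ^ 2) * k ^ 2 * hσ
  have key2 := mul_left_cancel₀ g.ne' key
  rw [key2] at S
  have : σ * (k ^ 2 - 2 * σ * k) = σ * k ^ 2 - 2 * k := by linear_combination (-2 * k) * hσ
  linarith

lemma PF_cont (h : SWave ε r Λ u η) : Continuous (PF u) := by
  have c0 := h.su.cont
  have c1 := h.su.dx.cont
  have c2 := h.su.dy.cont
  unfold PF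
  fun_prop

lemma PF_per (h : SWave ε r Λ u η) (x y : ℝ) : PF u (x + 2 * Λ, y) = PF u (x, y) := by
  simp only [PF, h.per_dx, h.per_dy, h.uper]

lemma PF_top (h : SWave ε r Λ u η) (x : ℝ) : PF u (x, η x) = 2 * (r - 1 - ε * η x) := by
  simp only [PF, h.bern, h.top]; ring

lemma PF_bot (h : SWave ε r Λ u η) (x : ℝ) : PF u (x, 0) = DY u (x, 0) ^ 2 := by
  simp only [PF, h.bot, h.bot_dx]; ring

lemma isLocalMax_of (h : SWave ε r Λ u η) {g : ℝ × ℝ → ℝ} {x y : ℝ} (h0 : 0 < y) (h1 : y < η x)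
    (hm : ∀ x' y', 0 ≤ y' → y' ≤ η x' → g (x', y') ≤ g (x, y)) : IsLocalMax g (x, y) := by
  filter_upwards [h.open_dom h0 h1] with p hp
  exact hm p.1 p.2 hp.1.le hp.2.le

/-- Lower bound for the P-function. -/
lemma PF_ge (h : SWave ε r Λ u η) {x y : ℝ} (h0 : 0 ≤ y) (h1 : y ≤ η x) :
    min 0 (2 * (r - 1 - ε * η 0)) ≤ PF u (x, y) := by
  apply le_of_forall_pos_le_add
  intro δ' hδ'
  set δ := min δ' (1 / 2) with hδ
  have δpos : 0 < δ := by positivity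
  have δlt : δ < 1 := lt_of_le_of_lt (min_le_right _ _) (by norm_num)
  have c0 := h.su.cont
  have c1 := h.PF_cont
  obtain ⟨a, b, hb0, hb1, hm⟩ := h.attain_dom
    (g := fun p => (-1) * PF u p + (-δ * u p)) (by fun_prop)
    (fun x y => by simp only [h.PF_per, h.uper])
  have key := hm x y h0 h1
  have u1 := h.u_le_one h0 h1
  have hle : δ ≤ δ' := min_le_left _ _
  rcases hb0.eq_or_lt with e | hb0
  · subst e
    rw [h.PF_bot, h.bot] at key
    have : min 0 (2 * (r - 1 - ε * η 0)) ≤ 0 := min_le_left _ _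
    nlinarith [sq_nonneg (DY u (a, 0))]
  rcases hb1.eq_or_lt with e | hb1
  · subst e
    rw [h.PF_top, h.top] at key
    have : min 0 (2 * (r - 1 - ε * η 0)) ≤ (2 * (r - 1 - ε * η 0)) := min_le_right _ _
    have := h.eta_le a
    nlinarith [h.eps_pos]
  · exfalso
    have := h.PF_crit (σ := -1) (by norm_num) (f := fun t => -δ * t) (f' := fun _ => -δ)
      (f'' := fun _ => 0) (fun t => by simpa using (hasDerivAt_id t).const_mul (-δ))
      (fun t => hasDerivAt_const t _) hb0 hb1 (h.isLocalMax_of hb0 hb1 hm)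
    nlinarith

/-- Upper bound for the P-function. -/
lemma PF_le (h : SWave ε r Λ u η) {x y : ℝ} (h0 : 0 ≤ y) (h1 : y ≤ η x) :
    PF u (x, y) ≤ max 0 (2 * (r - 1 - ε * η Λ)) := by
  set K0 := max 0 (2 * (r - 1 - ε * η Λ)) with hK0
  by_contra hc
  push Not at hc
  set K := PF u (x, y) with hK
  have K0n : 0 ≤ K0 := le_max_left _ _
  have Kp : 0 < K := lt_of_le_of_lt K0n hc
  set l := 4 / K with hl
  have lp : 0 < l := by positivity
  set δ := (min ((K - K0) / 2) (K / 2)) / exp l with hδ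
  have mp : 0 < min ((K - K0) / 2) (K / 2) := lt_min (by linarith) (by linarith)
  have δp : 0 < δ := by positivity
  have δe : δ * exp l = min ((K - K0) / 2) (K / 2) := by
    rw [hδ]; field_simp
  have q1 : δ * exp l ≤ (K - K0) / 2 := δe ▸ min_le_left _ _
  have q2 : δ * exp l ≤ K / 2 := δe ▸ min_le_right _ _
  have c0 := h.su.cont
  have c1 := h.PF_cont
  obtain ⟨a, b, hb0, hb1, hm⟩ := h.attain_dom
    (g := fun p => 1 * PF u p + δ * exp (l * u p)) (by fun_prop)
    (fun x y => by simp only [h.PF_per, h.uper])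
  have key := hm x y h0 h1
  have E0 : 0 < δ * exp (l * u (x, y)) := by positivity
  have ub := h.u_le_one hb0 hb1
  have ub0 := h.u_nonneg hb0 hb1
  have E1 : δ * exp (l * u (a, b)) ≤ δ * exp l := by
    gcongr
    nlinarith
  have Fab : K / 2 ≤ PF u (a, b) := by rw [← hK] at key; linarith
  have gab : K / 2 ≤ DX u (a, b) ^ 2 + DY u (a, b) ^ 2 := by
    unfold PF at Fab; linarith
  rcases hb0.eq_or_lt with e | hb0
  · subst e
    have yp : 0 < DY u (a, 0) := by
      have := h.unic a 0 le_rfl hb1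
      rcases this.eq_or_lt with e | e
      · rw [h.bot_dx, ← e] at gab; norm_num at gab; linarith
      · exact e
    have s := h.su
    have d := (((((s.dx.hy a 0).pow 2).add ((s.dy.hy a 0).pow 2)).sub
      ((s.hy a 0).const_mul 2)).const_mul 1).add ((((s.hy a 0).const_mul l).exp).const_mul δ)
    have := deriv_nonpos_of_max_right (h.pos a) d (fun t h2 h3 => hm a t h2.le h3.le)
    have L := h.lapc a 0 le_rfl hb1
    rw [h.bot_dxx] at L
    have L' : DY (DY u) (a, 0) = 1 := by linarith
    rw [h.bot_dx, h.bot, L'] at this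
    simp at this
    have : 0 < δ * (l * DY u (a, 0)) := by positivity
    linarith
  rcases hb1.eq_or_lt with e | hb1
  · subst e
    rw [h.PF_top, h.top] at key
    rw [h.top] at E1
    have : (2 * (r - 1 - ε * η Λ)) ≤ K0 := le_max_right _ _
    have := h.eta_ge a
    have : ε * η Λ ≤ ε * η a := by gcongr; exact h.eps_pos.le
    rw [mul_one] at key
    linarith
  · have hexp : ∀ t, HasDerivAt (fun t => δ * exp (l * t)) (δ * (exp (l * t) * l)) t := fun t => by
      simpa using ((((hasDerivAt_id t).const_mul l).exp).const_mul δ)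
    have hexp' : ∀ t, HasDerivAt (fun t => δ * (exp (l * t) * l)) (δ * (exp (l * t) * l * l)) t :=
      fun t => by
      simpa using (((((hasDerivAt_id t).const_mul l).exp).mul_const l).const_mul δ)
    have := h.PF_crit (σ := 1) (by norm_num) hexp hexp' hb0 hb1 (h.isLocalMax_of hb0 hb1 hm)
    have e1 : l * (K / 2) = 2 := by rw [hl]; field_simp; norm_num
    have e2 : 2 ≤ l * (DX u (a, b) ^ 2 + DY u (a, b) ^ 2) := by
      rw [← e1]; gcongr
    have e3 : 0 < δ * (exp (l * u (a, b)) * l) := by positivity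
    nlinarith [sq_nonneg (δ * (exp (l * u (a, b)) * l))]

end SWave

/-! ### Column estimates -/
namespace SWave

variable {ε r Λ : ℝ} {u : ℝ × ℝ → ℝ} {η : ℝ → ℝ}

lemma sqrt_col (h : SWave ε r Λ u η) {s : ℝ} (hs : 0 < s)
    (hP : ∀ x y, 0 ≤ y → y ≤ η x → PF u (x, y) ≤ s ^ 2) {x y : ℝ} (h0 : 0 ≤ y) (h1 : y ≤ η x) :
    √(2 * u (x, y) + s ^ 2) ≤ s + y := by
  have c := h.su.cont
  have hpos : ∀ t ∈ Set.Icc 0 (η x), 0 < 2 * u (x, t) + s ^ 2 := by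
    intro t ht
    have := h.u_nonneg ht.1 ht.2
    positivity
  have hd : ∀ t ∈ Set.Icc 0 (η x), HasDerivAt (fun t => √(2 * u (x, t) + s ^ 2) - t)
      ((2 * DY u (x, t)) / (2 * √(2 * u (x, t) + s ^ 2)) - 1) t := by
    intro t ht
    exact (((((h.su.hy x t).const_mul 2).add_const (s ^ 2)).sqrt (hpos t ht).ne').sub
      (hasDerivAt_id t))
  have hm : AntitoneOn (fun t => √(2 * u (x, t) + s ^ 2) - t) (Set.Icc 0 (η x)) := by
    refine antitoneOn_of_deriv_nonpos (convex_Icc _ _) (by fun_prop) ?_ ?_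
    · intro t ht
      exact (hd t (interior_subset ht)).differentiableAt.differentiableWithinAt
    · intro t ht
      have ht' := interior_subset ht
      rw [(hd t ht').deriv]
      have p1 := hpos t ht'
      have p2 := hP x t ht'.1 ht'.2
      unfold PF at p2
      have p3 : DY u (x, t) ≤ √(2 * u (x, t) + s ^ 2) := by
        apply Real.le_sqrt_of_sq_le
        nlinarith [sq_nonneg (DX u (x, t))]
      have p4 : 0 < √(2 * u (x, t) + s ^ 2) := Real.sqrt_pos.2 p1
      rw [sub_nonpos, div_le_one (by positivity)]
      linarith
  have := hm ⟨le_rfl, (h.pos x).le⟩ ⟨h0, h1⟩ h0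
  simp only [h.bot] at this
  rw [mul_zero, zero_add, Real.sqrt_sq hs.le] at this
  linarith

lemma u_le_of (h : SWave ε r Λ u η) {s : ℝ} (hs : 0 < s)
    (hP : ∀ x y, 0 ≤ y → y ≤ η x → PF u (x, y) ≤ s ^ 2) {x y : ℝ} (h0 : 0 ≤ y) (h1 : y ≤ η x) :
    u (x, y) ≤ y ^ 2 / 2 + s * y := by
  have a := h.sqrt_col hs hP h0 h1
  have b := (Real.sqrt_le_left (by positivity)).1 a
  nlinarith

lemma w_le_of (h : SWave ε r Λ u η) {s : ℝ} (hs : 0 < s)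
    (hP : ∀ x y, 0 ≤ y → y ≤ η x → PF u (x, y) ≤ s ^ 2) {x y : ℝ} (h0 : 0 ≤ y) (h1 : y ≤ η x) :
    DY u (x, y) ≤ y + s := by
  have a := h.sqrt_col hs hP h0 h1
  have p2 := hP x y h0 h1
  unfold PF at p2
  have p3 : DY u (x, y) ≤ √(2 * u (x, y) + s ^ 2) := by
    apply Real.le_sqrt_of_sq_le
    nlinarith [sq_nonneg (DX u (x, y))]
  linarith

lemma sqrt2_le_of {e s : ℝ} (he : 0 < e) (hs : 0 < s) (h : 1 ≤ e ^ 2 / 2 + s * e) : √2 ≤ e + s := by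
  apply Real.sqrt_le_iff.2
  constructor
  · positivity
  · nlinarith

lemma PF_small (h : SWave ε r Λ u η) {x y : ℝ} (h0 : 0 ≤ y) (h1 : y ≤ η x) :
    PF u (x, y) ≤ (2 * ε) ^ 2 := by
  have he := h.eps_pos
  have h2 := fun x y h0 h1 => h.PF_le (x := x) (y := y) h0 h1
  by_cases hK : 2 * (r - 1 - ε * η Λ) ≤ 0
  · rw [max_eq_left hK] at h2
    exact (h2 x y h0 h1).trans (by positivity)
  · push Not at hK
    rw [max_eq_right hK.le] at h2
    set s := √(2 * (r - 1 - ε * η Λ)) with hs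
    have sp : 0 < s := Real.sqrt_pos.2 hK
    have ss : s ^ 2 = 2 * (r - 1 - ε * η Λ) := Real.sq_sqrt hK.le
    rw [← ss] at h2
    refine (h2 x y h0 h1).trans ?_
    have t := h.u_le_of sp h2 (h.pos Λ).le le_rfl
    rw [h.top] at t
    have t2 := sqrt2_le_of (h.pos Λ) sp t
    have rl := h.r_le
    have s2 : s ≤ 2 * ε := by
      have : s ^ 2 ≤ 2 * ε * s := by nlinarith
      nlinarith
    gcongr

lemma trough_ge (h : SWave ε r Λ u η) : √2 - 2 * ε ≤ η Λ := by
  have he := h.eps_pos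
  have t := h.u_le_of (s := 2 * ε) (by positivity) (fun x y a b => h.PF_small a b) (h.pos Λ).le le_rfl
  rw [h.top] at t
  have := sqrt2_le_of (h.pos Λ) (by positivity) t
  linarith

end SWave

/-! ### The gradient estimate by reflection and Borel-Caratheodory -/

/-- The complex function `A + i B`. -/
def cx (A B : ℝ × ℝ → ℝ) (x0 : ℝ) (z : ℂ) : ℂ :=
  (A (x0 + z.re, z.im) : ℂ) + Complex.I * (B (x0 + z.re, z.im) : ℂ)

lemma cx_deriv {A B : ℝ × ℝ → ℝ} (hA : Sm A) (hB : Sm B) (x0 : ℝ) (z : ℂ)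
    (c1 : DX A (x0 + z.re, z.im) = DY B (x0 + z.re, z.im))
    (c2 : DY A (x0 + z.re, z.im) = - DX B (x0 + z.re, z.im)) :
    HasDerivAt (cx A B x0) ((DX A (x0 + z.re, z.im) : ℂ) +
      Complex.I * (DX B (x0 + z.re, z.im) : ℂ)) z := by
  have hT : HasFDerivAt (fun z : ℂ => ((x0 + z.re, z.im) : ℝ × ℝ))
      (Complex.reCLM.prod Complex.imCLM) z :=
    (Complex.reCLM.hasFDerivAt.const_add x0).prodMk Complex.imCLM.hasFDerivAt
  have hA1 := (hA.diff (x0 + z.re, z.im)).hasFDerivAt.comp z hT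
  have hB1 := (hB.diff (x0 + z.re, z.im)).hasFDerivAt.comp z hT
  have hA2 := Complex.ofRealCLM.hasFDerivAt.comp z hA1
  have hB2 := (Complex.ofRealCLM.hasFDerivAt.comp z hB1).const_mul Complex.I
  have h := hA2.add hB2
  have h' : HasFDerivAt (𝕜 := ℝ) (cx A B x0) _ z := h
  have e1 : ∀ C : ℝ × ℝ → ℝ, fderiv ℝ C (x0 + z.re, z.im) (1, 0) = DX C (x0 + z.re, z.im) :=
    fun C => rfl
  have e2 : ∀ C : ℝ × ℝ → ℝ, fderiv ℝ C (x0 + z.re, z.im) (0, 1) = DY C (x0 + z.re, z.im) :=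
    fun C => rfl
  have := h'.complexOfReal_hasFDerivAt (by
    simp [e1, e2, c1, c2]
    rw [mul_add, ← mul_assoc, Complex.I_mul_I]; ring)
  have h2 := this.hasDerivAt
  refine h2.congr_deriv ?_
  rw [ContinuousLinearMap.coe_complexOfReal]
  simp [e1]

namespace SWave

variable {ε r Λ : ℝ} {u : ℝ × ℝ → ℝ} {η : ℝ → ℝ}

lemma disc (h : SWave ε r Λ u η) {s : ℝ} (hs : 0 < s)
    (hP : ∀ x y, 0 ≤ y → y ≤ η x → PF u (x, y) ≤ s ^ 2) (x y : ℝ) (h0 : 0 ≤ y) (h1 : y < η Λ) :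
    |DX u (x, y)| ≤ 4 * s * η Λ / (η Λ - y) ∧ |y + s - DY u (x, y)| ≤ 4 * s * η Λ / (η Λ - y) := by
  set R := η Λ with hR
  have Rp : 0 < R := h.pos Λ
  set A : ℝ × ℝ → ℝ := fun p => p.2 + s - DY u p with hA
  set B : ℝ × ℝ → ℝ := fun p => - DX u p with hB
  set A' : ℝ × ℝ → ℝ := fun p => A (p.1, -p.2) with hA'
  set B' : ℝ × ℝ → ℝ := fun p => - B (p.1, -p.2) with hB'
  have sy : Sm (DY u) := h.su.dy
  have sx : Sm (DX u) := h.su.dx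
  have sA : Sm A := by unfold Sm at *; fun_prop
  have sB : Sm B := by unfold Sm at *; fun_prop
  have sA' : Sm A' := by unfold Sm at *; fun_prop
  have sB' : Sm B' := by unfold Sm at *; fun_prop
  have dAx : ∀ a b, DX A (a, b) = - DX (DY u) (a, b) := fun a b =>
    dx_eq sA (by simpa using (sy.hx a b).const_sub (b + s))
  have dAy : ∀ a b, DY A (a, b) = 1 - DY (DY u) (a, b) := fun a b =>
    dy_eq sA (((hasDerivAt_id b).add_const s).sub (sy.hy a b))
  have dBx : ∀ a b, DX B (a, b) = - DX (DX u) (a, b) := fun a b => dx_eq sB (sx.hx a b).neg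
  have dBy : ∀ a b, DY B (a, b) = - DY (DX u) (a, b) := fun a b => dy_eq sB (sx.hy a b).neg
  have dA'x : ∀ a b, DX A' (a, b) = DX A (a, -b) := fun a b => dx_eq sA' (sA.hx a (-b))
  have dB'x : ∀ a b, DX B' (a, b) = - DX B (a, -b) := fun a b => dx_eq sB' (sB.hx a (-b)).neg
  have dA'y : ∀ a b, DY A' (a, b) = - DY A (a, -b) := fun a b => dy_eq sA' (by
    have := (sA.hy a (-b)).scomp b (hasDerivAt_neg b)
    simpa [Function.comp_def] using this)
  have dB'y : ∀ a b, DY B' (a, b) = DY B (a, -b) := fun a b => dy_eq sB' (by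
    have := ((sB.hy a (-b)).scomp b (hasDerivAt_neg b)).neg
    exact this.congr_deriv (by simp))
  have CR1 : ∀ a b, DX A (a, b) = DY B (a, b) := fun a b => by rw [dAx, dBy, h.su.comm]
  have CR2 : ∀ a b, 0 ≤ b → b ≤ η a → DY A (a, b) = - DX B (a, b) := fun a b i j => by
    rw [dAy, dBx]; linarith [h.lapc a b i j]
  set G : ℂ → ℂ := fun z => if 0 ≤ z.im then cx A B x z else cx A' B' x z with hG
  have inD : ∀ z : ℂ, z ∈ Metric.ball (0 : ℂ) R → |z.im| < R := fun z hz =>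
    (Complex.abs_im_le_norm z).trans_lt (by simpa using hz)
  have hdu : ∀ z : ℂ, z ∈ Metric.ball (0 : ℂ) R → 0 ≤ z.im → HasDerivAt (cx A B x)
      ((DX A (x + z.re, z.im) : ℂ) + Complex.I * (DX B (x + z.re, z.im) : ℂ)) z := fun z hz hi =>
    cx_deriv sA sB x z (CR1 _ _) (CR2 _ _ hi (by
      have := inD z hz
      rw [abs_of_nonneg hi] at this
      exact this.le.trans (h.eta_ge _)))
  have hdl : ∀ z : ℂ, z ∈ Metric.ball (0 : ℂ) R → z.im ≤ 0 → HasDerivAt (cx A' B' x)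
      ((DX A' (x + z.re, z.im) : ℂ) + Complex.I * (DX B' (x + z.re, z.im) : ℂ)) z := fun z hz hi =>
    cx_deriv sA' sB' x z (by rw [dA'x, dB'y, CR1]) (by
      rw [dA'y, dB'x, CR2 _ _ (by linarith)]
      have := inD z hz
      rw [abs_of_nonpos hi] at this
      exact this.le.trans (h.eta_ge _))
  have Gu : ∀ z : ℂ, 0 ≤ z.im → G z = cx A B x z := fun z hz => if_pos hz
  have Gl : ∀ z : ℂ, z.im ≤ 0 → G z = cx A' B' x z := fun z hz => by
    rcases hz.eq_or_lt with e | e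
    · rw [Gu z e.ge]
      simp only [cx, hA', hB', hB, e, neg_zero, h.bot_dx]
    · exact if_neg (not_le.2 e)
  have hdiff : DifferentiableOn ℂ G (Metric.ball 0 R) := by
    intro z hz
    apply DifferentiableAt.differentiableWithinAt
    rcases lt_trichotomy z.im 0 with hi | hi | hi
    · refine ((hdl z hz hi.le).congr_of_eventuallyEq ?_).differentiableAt
      have : ∀ᶠ w : ℂ in nhds z, w.im < 0 :=
        (isOpen_lt Complex.continuous_im continuous_const).mem_nhds hi
      filter_upwards [this] with w hw using Gl w hw.le
    · have d1 := ((hdu z hz hi.ge).hasDerivWithinAt (s := {w : ℂ | 0 ≤ w.im})).congr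
        (fun w hw => Gu w hw) (Gu z hi.ge)
      have d2 := ((hdl z hz hi.le).hasDerivWithinAt (s := {w : ℂ | w.im ≤ 0})).congr
        (fun w hw => Gl w hw) (Gl z hi.le)
      have e0 : (DX A' (x + z.re, z.im) : ℂ) + Complex.I * (DX B' (x + z.re, z.im) : ℂ) =
          (DX A (x + z.re, z.im) : ℂ) + Complex.I * (DX B (x + z.re, z.im) : ℂ) := by
        rw [hi, dA'x, dB'x, neg_zero, dBx, h.bot_dxx]; simp
      rw [e0] at d2
      have := d1.union d2
      have un : {w : ℂ | 0 ≤ w.im} ∪ {w : ℂ | w.im ≤ 0} = Set.univ := by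
        ext w; simp [le_total]
      rw [un, hasDerivWithinAt_univ] at this
      exact this.differentiableAt
    · refine ((hdu z hz hi.le).congr_of_eventuallyEq ?_).differentiableAt
      have : ∀ᶠ w : ℂ in nhds z, 0 < w.im :=
        (isOpen_lt continuous_const Complex.continuous_im).mem_nhds hi
      filter_upwards [this] with w hw using Gu w hw.le
  have Apos : ∀ a b, 0 ≤ b → b ≤ η a → 0 ≤ A (a, b) := fun a b i j => by
    have := h.w_le_of hs hP i j
    simp only [hA]; linarith
  have hmap : Set.MapsTo (fun z => - G z) (Metric.ball 0 R) {z | z.re ≤ s} := by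
    intro z hz
    have hi := inD z hz
    change (- G z).re ≤ s
    rcases le_total 0 z.im with i | i
    · rw [abs_of_nonneg i] at hi
      have := Apos (x + z.re) z.im i (hi.le.trans (h.eta_ge _))
      rw [Gu z i]; simp [cx]; linarith
    · rw [abs_of_nonpos i] at hi
      have := Apos (x + z.re) (-z.im) (by linarith) (hi.le.trans (h.eta_ge _))
      rw [Gl z i]; simp [cx, hA']; linarith
  set z : ℂ := ⟨0, y⟩ with hz
  have nz : ‖z‖ = y := by
    have : z = (y : ℂ) * Complex.I := by apply Complex.ext <;> simp [hz]
    rw [this]; simp [abs_of_nonneg h0]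
  have hzb : z ∈ Metric.ball (0 : ℂ) R := by simpa [nz] using h1
  have bc := Complex.borelCaratheodory hs hdiff.neg hmap Rp hzb
  rw [nz] at bc
  have G0 : ‖- G 0‖ ≤ s := by
    rw [norm_neg, Gu 0 (by simp)]
    have e : cx A B x 0 = ((A (x, 0) : ℝ) : ℂ) := by
      simp [cx, hB, h.bot_dx]
    rw [e, Complex.norm_real, Real.norm_of_nonneg (Apos x 0 le_rfl (h.pos x).le)]
    have := h.unic x 0 le_rfl (h.pos x).le
    simp only [hA]; linarith
  have ry : 0 < R - y := by linarith
  have bound : ‖G z‖ ≤ 4 * s * R / (R - y) := by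
    simp only [Pi.neg_apply, norm_neg] at bc
    rw [norm_neg] at G0
    refine bc.trans ?_
    rw [← add_div]
    gcongr
    nlinarith [norm_nonneg (G 0)]
  rw [Gu z h0] at bound
  have re : (cx A B x z).re = y + s - DY u (x, y) := by simp [cx, hA, hz]
  have im : (cx A B x z).im = - DX u (x, y) := by simp [cx, hB, hz]
  constructor
  · rw [← abs_neg, ← im]; exact (Complex.abs_im_le_norm _).trans bound
  · rw [← re]; exact (Complex.abs_re_le_norm _).trans bound

end SWave

/-! ### Consequences of the gradient estimate -/
namespace SWave

variable {ε r Λ : ℝ} {u : ℝ × ℝ → ℝ} {η : ℝ → ℝ}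

lemma col_mono (h : SWave ε r Λ u η) {b k x : ℝ} (hb : 0 ≤ b)
    (hk : ∀ t, 0 < t → t < b → t - k ≤ DY u (x, t)) : b ^ 2 / 2 - k * b ≤ u (x, b) := by
  have c := h.su.cont
  have hd : ∀ t, HasDerivAt (fun t => u (x, t) - (t ^ 2 / 2 - k * t)) (DY u (x, t) - (t - k)) t := by
    intro t
    have := (h.su.hy x t).sub ((((hasDerivAt_id t).pow 2).div_const 2).sub
      ((hasDerivAt_id t).const_mul k))
    refine this.congr_deriv ?_
    simp
  have hm : MonotoneOn (fun t => u (x, t) - (t ^ 2 / 2 - k * t)) (Set.Icc 0 b) := by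
    refine monotoneOn_of_deriv_nonneg (convex_Icc _ _) (by fun_prop)
      (fun t _ => (hd t).differentiableAt.differentiableWithinAt) ?_
    intro t ht
    rw [interior_Icc] at ht
    rw [(hd t).deriv]
    linarith [hk t ht.1 ht.2]
  have := hm ⟨le_rfl, hb⟩ ⟨hb, le_rfl⟩ hb
  simp only [h.bot] at this
  linarith

lemma trough_le (h : SWave ε r Λ u η) : η Λ ≤ √2 := by
  have he := h.eps_pos
  by_cases hK : 2 * (r - 1 - ε * η Λ) ≤ 0
  · have h2 : ∀ s : ℝ, ∀ x y, 0 ≤ y → y ≤ η x → PF u (x, y) ≤ s ^ 2 := fun s x y h0 h1 =>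
      (h.PF_le h0 h1).trans (by rw [max_eq_left hK]; positivity)
    have key : ∀ t, 0 < t → t < η Λ → t - 0 ≤ DY u (Λ, t) := by
      intro t ht0 ht1
      have hpos : 0 < η Λ - t := by linarith
      set k := 4 * η Λ / (η Λ - t) with hk
      have kp : 0 ≤ k := div_nonneg (by linarith) hpos.le
      apply le_of_forall_pos_le_add
      intro δ hδ
      have sp : 0 < δ / (k + 1) := by positivity
      have := (h.disc sp (h2 _) Λ t ht0.le ht1).2
      have e : 4 * (δ / (k + 1)) * η Λ / (η Λ - t) = δ / (k + 1) * k := by rw [hk]; ring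
      rw [e] at this
      have e2 : δ / (k + 1) * k ≤ δ := by
        rw [div_mul_eq_mul_div, div_le_iff₀ (by positivity)]; nlinarith
      have := (abs_le.1 this).2
      linarith
    have := h.col_mono (h.pos Λ).le key
    rw [h.top] at this
    apply Real.le_sqrt_of_sq_le
    linarith
  · push Not at hK
    have := h.r_le
    have : ε * η Λ ≤ ε * √2 := by nlinarith
    exact le_of_mul_le_mul_left this he

/-- closeness to the laminar flow below the trough -/
lemma near (h : SWave ε r Λ u η) {δ : ℝ} (hδ : 4 * ε ≤ δ) {x y : ℝ} (h0 : 0 ≤ y)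
    (h1 : y ≤ √2 - δ) : |DX u (x, y)| ≤ 24 * ε / δ ∧ y - 24 * ε / δ ≤ DY u (x, y) ∧
      y ^ 2 / 2 - 24 * ε / δ * y ≤ u (x, y) := by
  have he := h.eps_pos
  have s2 : √2 ≤ 3 / 2 := Real.sqrt_le_iff.2 ⟨by norm_num, by norm_num⟩
  have tl := h.trough_le
  have tg := h.trough_ge
  have main : ∀ t, 0 ≤ t → t ≤ √2 - δ → |DX u (x, t)| ≤ 24 * ε / δ ∧
      t - 24 * ε / δ ≤ DY u (x, t) := by
    intro t t0 t1
    have d := h.disc (s := 2 * ε) (by positivity) (fun x y a b => h.PF_small a b) x t t0 (by linarith)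
    have b : 4 * (2 * ε) * η Λ / (η Λ - t) ≤ 24 * ε / δ := by
      rw [div_le_div_iff₀ (by linarith) (by linarith)]
      have : δ ≤ 2 * (η Λ - t) := by linarith
      have : 8 * ε * η Λ ≤ 12 * ε := by nlinarith
      nlinarith
    exact ⟨d.1.trans b, by linarith [(abs_le.1 (d.2.trans b)).2]⟩
  refine ⟨(main y h0 h1).1, (main y h0 h1).2, ?_⟩
  exact h.col_mono h0 (fun t a b => (main t a.le (by linarith)).2)

end SWave

/-! ### A priori bound on the height of the wave -/
namespace SWave

variable {ε r Λ : ℝ} {u : ℝ × ℝ → ℝ} {η : ℝ → ℝ}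

lemma speed (h : SWave ε r Λ u η) (hε : ε ≤ 1 / 1000) {x y : ℝ} (h0 : 0 ≤ y) (h1 : y ≤ η x) :
    DX u (x, y) ^ 2 + DY u (x, y) ^ 2 ≤ 9 / 4 := by
  have a := h.PF_small h0 h1
  have b := h.u_le_one h0 h1
  have := h.eps_pos
  unfold PF at a
  nlinarith

lemma v_le (h : SWave ε r Λ u η) (hε : ε ≤ 1 / 1000) {x y : ℝ} (h0 : 0 ≤ y) (h1 : y ≤ η x) :
    |DX u (x, y)| ≤ 3 / 2 := by
  have a := h.speed hε h0 h1
  apply abs_le_of_sq_le_sq _ (by norm_num)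
  nlinarith [sq_nonneg (DY u (x, y))]

lemma top_v_nonneg (h : SWave ε r Λ u η) {x : ℝ} (h0 : 0 ≤ x) (h1 : x < Λ) :
    0 ≤ DX u (x, η x) := by
  have d : deriv η x ≤ 0 := deriv_nonpos_of_max_right h1 (h.ed x) (fun t a b =>
    h.anti.antitoneOn ⟨h0, h1.le⟩ ⟨by linarith, b.le⟩ a.le)
  have w := h.unic x (η x) (h.pos x).le le_rfl
  rw [h.top_dx]
  nlinarith

/-- horizontal Lipschitz estimate for `1 - u` below a surface point -/
lemma lip_row (h : SWave ε r Λ u η) (hε : ε ≤ 1 / 1000) {x a : ℝ} (h0 : 0 ≤ x) (h1 : x ≤ a)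
    (h2 : a ≤ Λ) : 1 - u (x, η a) ≤ 3 / 2 * (a - x) := by
  have key : ∀ t ∈ Set.Icc x a, ‖DX u (t, η a)‖ ≤ 3 / 2 := fun t ht => by
    refine h.v_le hε (h.pos a).le ?_
    exact h.anti.antitoneOn ⟨h0.trans ht.1, ht.2.trans h2⟩ ⟨h0.trans h1, h2⟩ ht.2
  have := (convex_Icc x a).norm_image_sub_le_of_norm_hasDerivWithin_le
    (fun t _ => (h.su.hx t (η a)).hasDerivWithinAt) key ⟨le_rfl, h1⟩ ⟨h1, le_rfl⟩
  rw [h.top, Real.norm_eq_abs, Real.norm_eq_abs, abs_of_nonneg (by linarith : (0:ℝ) ≤ a - x)] at this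
  exact (le_abs_self _).trans this

set_option maxHeartbeats 1000000 in
lemma wide (h : SWave ε r Λ u η) (hε : ε ≤ 1 / 1000) {x3 : ℝ} (h5 : 5 < η 0)
    (hx0 : 0 < x3) (hx1 : x3 < Λ) (hx3 : η x3 = 3) : 1 / 50 ≤ x3 := by
  by_contra hc
  push Not at hc
  have an := h.anti.antitoneOn
  have ivt : ∀ v, 3 ≤ v → v ≤ 5 → ∃ a ∈ Set.Icc 0 x3, η a = v := fun v a b => by
    have := intermediate_value_Icc' hx0.le (h.ec.continuousOn (s := Set.Icc 0 x3))
    exact this ⟨by linarith, by linarith⟩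
  obtain ⟨x5, ⟨x50, x53⟩, e5⟩ := ivt 5 (by norm_num) (by norm_num)
  obtain ⟨x4, ⟨x40, x43⟩, e4⟩ := ivt 4 (by norm_num) (by norm_num)
  have lt_of : ∀ a b, 0 ≤ a → a ≤ x3 → 0 ≤ b → b ≤ x3 → η b < η a → a < b := by
    intro a b a0 a1 b0 b1 hab
    by_contra hh
    push Not at hh
    have := an ⟨b0, by linarith⟩ ⟨a0, by linarith⟩ hh
    linarith
  have x5p : 0 < x5 := lt_of _ _ le_rfl hx0.le x50 x53 (by linarith)
  have x54 : x5 < x4 := lt_of _ _ x50 x53 x40 x43 (by linarith)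
  have x4p : 0 < x4 := by linarith
  have ce := h.ec
  have cu := h.su.cont
  -- the touching parabola
  obtain ⟨xp, ⟨xpa, xpb⟩, hmax⟩ := (isCompact_Icc (a := x5) (b := x3)).exists_isMaxOn
    ⟨x4, x54.le, x43⟩ (f := fun x => x - 10 * x3 * (η x - 4) ^ 2) (by fun_prop)
  set t := xp - 10 * x3 * (η xp - 4) ^ 2 with ht
  have hmax' : ∀ x, x5 ≤ x → x ≤ x3 → x - 10 * x3 * (η x - 4) ^ 2 ≤ t := fun x a b => hmax ⟨a, b⟩
  have tpos : 0 < t := by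
    have := hmax' x4 x54.le x43
    rw [e4] at this
    norm_num at this
    linarith
  have tle : t ≤ x3 := by
    have : 0 ≤ 10 * x3 * (η xp - 4) ^ 2 := by positivity
    linarith
  have xp5 : x5 < xp := by
    rcases xpa.eq_or_lt with e | e
    · exfalso
      rw [← e, e5] at ht
      norm_num at ht
      linarith
    · exact e
  have xp3 : xp < x3 := by
    rcases xpb.eq_or_lt with e | e
    · exfalso
      rw [e, hx3] at ht
      norm_num at ht
      linarith
    · exact e
  have yp5 : η xp < 5 := by
    rw [← e5]; exact h.anti ⟨x50, by linarith⟩ ⟨by linarith, by linarith⟩ xp5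
  have yp3 : 3 < η xp := by
    rw [← hx3]; exact h.anti ⟨by linarith, by linarith⟩ ⟨by linarith, by linarith⟩ xp3
  set τ : ℝ × ℝ → ℝ := fun p => t + 10 * x3 * (p.2 - 4) ^ 2 - p.1 with hτ
  set F : ℝ × ℝ → ℝ := fun p => 1 - u p - (τ p - τ p ^ 2) with hF
  have su := h.su
  have sF : Sm F := by unfold Sm at *; fun_prop
  have cF := sF.cont
  have Fx : ∀ a b, DX F (a, b) = - DX u (a, b) + (1 - 2 * τ (a, b)) := fun a b => by
    refine dx_eq sF ?_
    have d1 : HasDerivAt (fun s => τ (s, b)) (-1) a := by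
      simpa using (hasDerivAt_id a).const_sub (t + 10 * x3 * (b - 4) ^ 2)
    have := ((su.hx a b).const_sub 1).sub (d1.sub (d1.pow 2))
    refine this.congr_deriv ?_
    norm_num; ring
  have Fy : ∀ a b, DY F (a, b) = - DY u (a, b) - 20 * x3 * (b - 4) * (1 - 2 * τ (a, b)) := fun a b => by
    refine dy_eq sF ?_
    have d1 : HasDerivAt (fun s => τ (a, s)) (20 * x3 * (b - 4)) b := by
      have := (((((hasDerivAt_id b).sub_const 4).pow 2).const_mul (10 * x3)).const_add t).sub_const a
      refine this.congr_deriv ?_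
      norm_num; ring
    have := ((su.hy a b).const_sub 1).sub (d1.sub (d1.pow 2))
    refine this.congr_deriv ?_
    norm_num; ring
  have Fxx : ∀ a b, DX (DX F) (a, b) = - DX (DX u) (a, b) + 2 := fun a b => by
    refine dx_eq sF.dx ?_
    have d1 : HasDerivAt (fun s => τ (s, b)) (-1) a := by
      simpa using (hasDerivAt_id a).const_sub (t + 10 * x3 * (b - 4) ^ 2)
    have := (su.dx.hx a b).neg.add ((d1.const_mul 2).const_sub 1)
    have e : (fun s => DX F (s, b)) = fun s => - DX u (s, b) + (1 - 2 * τ (s, b)) :=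
      funext fun s => Fx s b
    rw [e]
    refine this.congr_deriv ?_
    norm_num
  have Fyy : ∀ a b, DY (DY F) (a, b) = - DY (DY u) (a, b) - 20 * x3 * (1 - 2 * τ (a, b))
      + 2 * (20 * x3 * (b - 4)) ^ 2 := fun a b => by
    refine dy_eq sF.dy ?_
    have d1 : HasDerivAt (fun s => τ (a, s)) (20 * x3 * (b - 4)) b := by
      have := (((((hasDerivAt_id b).sub_const 4).pow 2).const_mul (10 * x3)).const_add t).sub_const a
      refine this.congr_deriv ?_
      norm_num; ring
    have d2 : HasDerivAt (fun s : ℝ => 20 * x3 * (s - 4)) (20 * x3) b := by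
      simpa using ((hasDerivAt_id b).sub_const 4).const_mul (20 * x3)
    have := (su.dy.hy a b).neg.sub (d2.mul ((d1.const_mul 2).const_sub 1))
    have e : (fun s => DY F (a, s)) = fun s => - DY u (a, s) - 20 * x3 * (s - 4) * (1 - 2 * τ (a, s)) :=
      funext fun s => Fy a s
    rw [e]
    refine this.congr_deriv ?_
    ring
  -- the comparison region
  set Ω : Set (ℝ × ℝ) := (Set.Icc 0 x3 ×ˢ Set.Icc 3 5) ∩ {p | p.2 ≤ η p.1} with hΩ
  have cΩ : IsCompact Ω := (isCompact_Icc.prod isCompact_Icc).inter_right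
    (isClosed_le continuous_snd (ce.comp continuous_fst))
  have mem : ∀ a b, 0 ≤ a → a ≤ x3 → 3 ≤ b → b ≤ 5 → b ≤ η a → (a, b) ∈ Ω :=
    fun a b a0 a1 b0 b1 hab => ⟨⟨⟨a0, a1⟩, ⟨b0, b1⟩⟩, hab⟩
  have τb : ∀ a b, 0 ≤ a → a ≤ x3 → 3 ≤ b → b ≤ 5 → τ (a, b) ≤ 11 * x3 ∧ - x3 ≤ τ (a, b) := by
    intro a b a0 a1 b0 b1
    have q : (b - 4) ^ 2 ≤ 1 := by nlinarith
    simp only [hτ]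
    constructor
    · nlinarith
    · have : 0 ≤ 10 * x3 * (b - 4) ^ 2 := by positivity
      linarith
  obtain ⟨⟨a, b⟩, ⟨⟨⟨a0, a1⟩, ⟨b0, b1⟩⟩, hab⟩, hm⟩ := cΩ.exists_isMaxOn
    ⟨(xp, η xp), mem _ _ (by linarith) xpb yp3.le yp5.le le_rfl⟩ cF.continuousOn
  simp only at a0 a1 b0 b1
  replace hab : b ≤ η a := hab
  have hm' : ∀ q ∈ Ω, F q ≤ F (a, b) := fun q hq => hm hq
  obtain ⟨τ1, τ2⟩ := τb a b a0 a1 b0 b1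
  have Fle : F (a, b) ≤ 0 := by
    -- points on the lines y = 3, y = 5
    have side : ∀ c, c ≤ x3 → a ≤ c → η c = b → (b - 4) ^ 2 = 1 → F (a, b) ≤ 0 := by
      intro c c3 ac ec eb
      have l := h.lip_row hε a0 ac (by linarith)
      rw [ec] at l
      have e : τ (a, b) = t + 10 * x3 - a := by simp only [hτ, eb]; ring
      have e1 : 2 * (x3 - a) ≤ τ (a, b) := by rw [e]; linarith
      have e2 : 3 / 4 * τ (a, b) ≤ τ (a, b) - τ (a, b) ^ 2 := by nlinarith
      simp only [hF]
      linarith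
    rcases b0.eq_or_lt with e | b0
    · exact side x3 le_rfl a1 (by rw [hx3, e]) (by rw [← e]; norm_num)
    rcases b1.eq_or_lt with e | b1
    · refine side x5 x53 ?_ (by rw [e5, e]) (by rw [e]; norm_num)
      by_contra hh
      push Not at hh
      have := h.anti ⟨x50, by linarith⟩ ⟨a0, by linarith⟩ hh
      linarith
    rcases hab.eq_or_lt with e | hab
    · have ax5 : x5 ≤ a := (lt_of _ _ x50 x53 a0 a1 (by linarith)).le
      have := hmax' a ax5 a1
      have τ0 : 0 ≤ τ (a, b) := by simp only [hτ]; rw [e]; linarith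
      simp only [hF]
      rw [show u (a, b) = 1 by rw [e, h.top]]
      nlinarith
    rcases a1.eq_or_lt with e | a1
    · rw [e] at hab; linarith
    rcases a0.eq_or_lt with e | a0
    · exfalso
      subst e
      have d := deriv_nonpos_of_max_right x5p (sF.hx 0 b) (fun s s0 s1 => hm' (s, b)
        (mem _ _ s0.le (by linarith) b0.le b1.le (by
          have := an ⟨s0.le, by linarith⟩ ⟨x50, by linarith⟩ s1.le
          linarith)))
      have v0 : DX u (0, b) = 0 := by
        have := h.even_dx 0 b
        rw [neg_zero] at this
        linarith
      rw [Fx, v0] at d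
      linarith
    · exfalso
      have op : IsOpen ((Set.Ioo 0 x3 ×ˢ Set.Ioo 3 5) ∩ {p : ℝ × ℝ | p.2 < η p.1}) :=
        (isOpen_Ioo.prod isOpen_Ioo).inter (isOpen_lt continuous_snd (ce.comp continuous_fst))
      have lm : IsLocalMax F (a, b) := by
        filter_upwards [op.mem_nhds (x := (a, b)) ⟨⟨⟨a0, a1⟩, ⟨b0, b1⟩⟩, hab⟩] with q hq
        have hq2 : q.2 < η q.1 := hq.2
        exact hm' q ⟨⟨⟨hq.1.1.1.le, hq.1.1.2.le⟩, ⟨hq.1.2.1.le, hq.1.2.2.le⟩⟩, le_of_lt hq2⟩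
      obtain ⟨-, -, s1, s2⟩ := sF.localMax lm
      rw [Fxx] at s1
      rw [Fyy] at s2
      have L := h.lap a b (by linarith) hab
      nlinarith [sq_nonneg (20 * x3 * (b - 4))]
  have τp : τ (xp, η xp) = 0 := by simp only [hτ, ht]; ring
  have Fp : F (xp, η xp) = 0 := by simp only [hF, τp, h.top]; norm_num
  have d1 := deriv_nonneg_of_max_left (l := 0) (by linarith) (sF.hx xp (η xp)) (fun s s0 s1 => by
    rw [Fp]
    exact (hm' (s, η xp) (mem _ _ s0.le (by linarith) yp3.le yp5.le
      (an ⟨s0.le, by linarith⟩ ⟨by linarith, by linarith⟩ s1.le))).trans Fle)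
  have d2 := deriv_nonneg_of_max_left (l := 3) yp3 (sF.hy xp (η xp)) (fun s s0 s1 => by
    rw [Fp]
    exact (hm' (xp, s) (mem _ _ (by linarith) (by linarith) s0.le (by linarith) s1.le)).trans Fle)
  rw [Fx, τp] at d1
  rw [Fy, τp] at d2
  have v0 := h.top_v_nonneg (x := xp) (by linarith) (by linarith)
  have w0 := h.unic xp (η xp) (h.pos _).le le_rfl
  have B := h.bern xp
  have lr := h.le_r
  have ep := h.eps_pos
  have w1 : DY u (xp, η xp) ≤ 2 / 5 := by
    have : x3 * (4 - η xp) ≤ x3 * 1 := by gcongr; linarith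
    linarith
  have s2 : 0 ≤ √2 := Real.sqrt_nonneg 2
  have q1 : ε * η xp ≤ ε * 5 := by gcongr
  have q2 : 0 ≤ √2 * ε := by positivity
  have q3 : ε ^ 2 ≤ ε := by rw [sq]; exact mul_le_of_le_one_left ep.le (by linarith)
  have q : (19 : ℝ) / 10 ≤ 2 * (r - ε * η xp) := by linarith
  have v1 : DX u (xp, η xp) ^ 2 ≤ 1 := pow_le_one₀ v0 (by linarith)
  have w2 : DY u (xp, η xp) ^ 2 ≤ (2 / 5) ^ 2 := by gcongr
  linarith

/-- The wave height is bounded by `5`. -/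
lemma eta_le5 (h : SWave ε r Λ u η) (hε : ε ≤ 1 / 10 ^ 12) (x : ℝ) : η x ≤ 5 := by
  refine (h.eta_le x).trans ?_
  by_contra hc
  push Not at hc
  have ep := h.eps_pos
  have s2 : √2 ≤ 3 / 2 := Real.sqrt_le_iff.2 ⟨by norm_num, by norm_num⟩
  have s2' : 1 ≤ √2 := Real.le_sqrt_of_sq_le (by norm_num)
  have ss : √2 ^ 2 = 2 := Real.sq_sqrt (by norm_num)
  have tl := h.trough_le
  obtain ⟨x3, ⟨x30, x31⟩, e3⟩ := intermediate_value_Icc' h.lam_pos.le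
    (h.ec.continuousOn (s := Set.Icc 0 Λ)) (show (3 : ℝ) ∈ Set.Icc (η Λ) (η 0) from
      ⟨by linarith, by linarith⟩)
  have x30' : 0 < x3 := by
    rcases x30.eq_or_lt with e | e
    · rw [← e] at e3; linarith
    · exact e
  have x31' : x3 < Λ := by
    rcases x31.eq_or_lt with e | e
    · rw [e] at e3; linarith
    · exact e
  have W := h.wide (by linarith) hc x30' x31' e3
  have big : ∀ t, |t| ≤ 1 / 50 → 3 ≤ η t := by
    intro t ht
    have e : η t = η |t| := by
      rcases abs_choice t with e | e
      · rw [e]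
      · rw [e, h.eeven]
    rw [e, ← e3]
    exact h.anti.antitoneOn ⟨abs_nonneg t, by linarith⟩ ⟨x30, x31⟩ (by linarith)
  set Y := √2 - 1 / 40000 with hY
  set S : Set (ℝ × ℝ) := {p | p.1 ^ 2 + (p.2 - Y) ^ 2 ≤ 1 / 2500} with hS
  have inS : ∀ a b, a ^ 2 + (b - Y) ^ 2 ≤ 1 / 2500 → |a| ≤ 1 / 50 ∧ |b - Y| ≤ 1 / 50 := by
    intro a b hab
    constructor
    · apply abs_le_of_sq_le_sq _ (by norm_num); nlinarith [sq_nonneg (b - Y)]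
    · apply abs_le_of_sq_le_sq _ (by norm_num); nlinarith [sq_nonneg a]
  have inD : ∀ a b, a ^ 2 + (b - Y) ^ 2 ≤ 1 / 2500 → 0 < b ∧ b < η a := by
    intro a b hab
    obtain ⟨q1, q2⟩ := inS a b hab
    have q3 := abs_le.1 q2
    exact ⟨by linarith, by linarith [big a q1]⟩
  have cS : IsCompact S := by
    refine IsCompact.of_isClosed_subset (isCompact_Icc.prod isCompact_Icc :
      IsCompact (Set.Icc (-(1 / 50) : ℝ) (1 / 50) ×ˢ Set.Icc (Y - 1 / 50) (Y + 1 / 50))) ?_ ?_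
    · exact isClosed_le (by fun_prop) continuous_const
    · rintro ⟨a, b⟩ hab
      obtain ⟨q1, q2⟩ := inS a b hab
      have q3 := abs_le.1 q1
      have q4 := abs_le.1 q2
      exact ⟨⟨q3.1, q3.2⟩, ⟨by linarith, by linarith⟩⟩
  have su := h.su
  set F : ℝ × ℝ → ℝ := fun p => u p - (p.1 ^ 2 + (p.2 - Y) ^ 2) / 8 with hF
  have sF : Sm F := by unfold Sm at *; fun_prop
  have Fx : ∀ a b, DX F (a, b) = DX u (a, b) - a / 4 := fun a b => by
    refine dx_eq sF ?_
    have := (su.hx a b).sub ((((hasDerivAt_id a).pow 2).add_const ((b - Y) ^ 2)).div_const 8)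
    refine this.congr_deriv ?_
    norm_num; ring
  have Fy : ∀ a b, DY F (a, b) = DY u (a, b) - (b - Y) / 4 := fun a b => by
    refine dy_eq sF ?_
    have := (su.hy a b).sub (((((hasDerivAt_id b).sub_const Y).pow 2).const_add (a ^ 2)).div_const 8)
    refine this.congr_deriv ?_
    norm_num; ring
  have Fxx : ∀ a b, DX (DX F) (a, b) = DX (DX u) (a, b) - 1 / 4 := fun a b => by
    refine dx_eq sF.dx ?_
    have e : (fun s => DX F (s, b)) = fun s => DX u (s, b) - s / 4 := funext fun s => Fx s b
    rw [e]
    exact (su.dx.hx a b).sub ((hasDerivAt_id a).div_const 4)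
  have Fyy : ∀ a b, DY (DY F) (a, b) = DY (DY u) (a, b) - 1 / 4 := fun a b => by
    refine dy_eq sF.dy ?_
    have e : (fun s => DY F (a, s)) = fun s => DY u (a, s) - (s - Y) / 4 := funext fun s => Fy a s
    rw [e]
    exact (su.dy.hy a b).sub (((hasDerivAt_id b).sub_const Y).div_const 4)
  have center : (0, Y) ∈ S := by simp [hS]
  obtain ⟨⟨a, b⟩, hab, hm⟩ := cS.exists_isMaxOn ⟨_, center⟩ sF.cont.continuousOn
  have hm' : ∀ q ∈ S, F q ≤ F (a, b) := fun q hq => hm hq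
  have hab' : a ^ 2 + (b - Y) ^ 2 ≤ 1 / 2500 := hab
  obtain ⟨bp, bη⟩ := inD a b hab'
  have key := hm' _ center
  have bd : F (a, b) ≤ 1 - 1 / 20000 := by
    rcases hab'.eq_or_lt with e | hlt
    · have := h.u_le_one bp.le bη.le
      simp only [hF, e]
      linarith
    · exfalso
      have op : IsOpen {p : ℝ × ℝ | p.1 ^ 2 + (p.2 - Y) ^ 2 < 1 / 2500} :=
        isOpen_lt (by fun_prop) continuous_const
      have lm : IsLocalMax F (a, b) := by
        filter_upwards [op.mem_nhds (x := (a, b)) hlt] with q hq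
        exact hm' q (le_of_lt hq)
      obtain ⟨-, -, s1, s2⟩ := sF.localMax lm
      rw [Fxx] at s1
      rw [Fyy] at s2
      have L := h.lap a b bp bη
      linarith
  have uY : u (0, Y) ≤ 1 - 1 / 20000 := by
    have : F (0, Y) = u (0, Y) := by simp [hF]
    linarith
  have n := (h.near (δ := 1 / 40000) (by linarith) (x := 0) (y := Y) (by linarith) le_rfl).2.2
  have n1 : 24 * ε / (1 / 40000) * Y ≤ 1440000 * ε := by
    have : Y ≤ 3 / 2 := by linarith
    have e : 24 * ε / (1 / 40000) = 960000 * ε := by ring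
    rw [e]; nlinarith
  have n2 : 1 - 3 / 2 / 40000 ≤ Y ^ 2 / 2 := by rw [hY]; nlinarith
  linarith

end SWave

/-! ### The slope estimate -/
namespace SWave

variable {ε r Λ : ℝ} {u : ℝ × ℝ → ℝ} {η : ℝ → ℝ}

lemma grad_ge (h : SWave ε r Λ u η) (hε : ε ≤ 1 / 10 ^ 12) {x y : ℝ} (h0 : 0 ≤ y) (h1 : y ≤ η x) :
    2 * u (x, y) - 10 * ε ≤ DX u (x, y) ^ 2 + DY u (x, y) ^ 2 := by
  have ep := h.eps_pos
  have a := h.PF_ge h0 h1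
  have b := h.eta_le5 hε 0
  have lr := h.le_r
  have s2' : 1 ≤ √2 := Real.le_sqrt_of_sq_le (by norm_num)
  have q1 : ε * η 0 ≤ ε * 5 := by gcongr
  have q2 : 1 * ε ≤ √2 * ε := by gcongr
  have q3 : ε ^ 2 ≤ ε := by rw [sq]; exact mul_le_of_le_one_left ep.le (by linarith)
  have : -(10 * ε) ≤ min 0 (2 * (r - 1 - ε * η 0)) := le_min (by linarith) (by linarith)
  unfold PF at a
  linarith

lemma q_ge (h : SWave ε r Λ u η) (hε : ε ≤ 1 / 10 ^ 12) (x : ℝ) :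
    1 ≤ DX u (x, η x) ^ 2 + DY u (x, η x) ^ 2 := by
  have := h.grad_ge hε (h.pos x).le le_rfl
  rw [h.top] at this
  linarith

lemma near13 (h : SWave ε r Λ u η) (hε : ε ≤ 1 / 10 ^ 12) {x y : ℝ} (h0 : 0 ≤ y)
    (h1 : y ≤ 13 / 10) : |DX u (x, y)| ≤ 240 * ε ∧ y - 240 * ε ≤ DY u (x, y) ∧
      y ^ 2 / 2 - 312 * ε ≤ u (x, y) := by
  have ep := h.eps_pos
  have s2 : (141 : ℝ) / 100 ≤ √2 := Real.le_sqrt_of_sq_le (by norm_num)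
  obtain ⟨a, b, c⟩ := h.near (δ := 1 / 10) (by linarith) (x := x) h0 (by linarith)
  have e : 24 * ε / (1 / 10) = 240 * ε := by ring
  rw [e] at a b c
  refine ⟨a, b, ?_⟩
  nlinarith

lemma eta_ge13 (h : SWave ε r Λ u η) (hε : ε ≤ 1 / 10 ^ 12) (x : ℝ) : 14 / 10 ≤ η x := by
  have s2 : (141 : ℝ) / 100 ≤ √2 := Real.le_sqrt_of_sq_le (by norm_num)
  have := h.trough_ge
  have := h.eta_ge x
  linarith

lemma u_ge_of_13 (h : SWave ε r Λ u η) (hε : ε ≤ 1 / 10 ^ 12) {x y : ℝ} (h0 : 13 / 10 ≤ y)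
    (h1 : y ≤ η x) : 8 / 10 ≤ u (x, y) := by
  have a := (h.near13 hε (x := x) (y := 13 / 10) (by norm_num) le_rfl).2.2
  have b := h.u_mono (by norm_num) h0 h1
  linarith

lemma y_gt_one (h : SWave ε r Λ u η) (hε : ε ≤ 1 / 10 ^ 12) {x y : ℝ} (h0 : 0 ≤ y)
    (h1 : y ≤ η x) (h2 : 2 / 3 ≤ u (x, y)) : 1 < y := by
  have ep := h.eps_pos
  have a := h.u_le_of (s := 2 * ε) (by positivity) (fun x y a b => h.PF_small a b) h0 h1
  by_contra hc
  push Not at hc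
  nlinarith

/-- Comparison function for the slope. -/
lemma slope_cmp (h : SWave ε r Λ u η) (hε : ε ≤ 1 / 10 ^ 12) {M : ℝ} (hM : 1000 * ε ≤ M)
    (hη : ∀ x, - deriv η x ≤ M) {x y : ℝ} (h0 : 0 ≤ y) (h1 : y ≤ η x) (h2 : 2 / 3 ≤ u (x, y)) :
    M * ((1 - u (x, y)) + (1 - u (x, y)) ^ 2) ≤ M * DY u (x, y) - DX u (x, y) := by
  have ep := h.eps_pos
  have Mp : 0 < M := by linarith
  have su := h.su
  have sx := su.dx
  have sy := su.dy
  have cu := su.cont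
  set F : ℝ × ℝ → ℝ := fun p => M * ((1 - u p) + (1 - u p) ^ 2) - M * DY u p + DX u p with hF
  have sF : Sm F := by unfold Sm at *; fun_prop
  have Fx : ∀ a b, DX F (a, b) = M * (- DX u (a, b) - 2 * (1 - u (a, b)) * DX u (a, b))
      - M * DX (DY u) (a, b) + DX (DX u) (a, b) := fun a b => by
    refine dx_eq sF ?_
    have d := (su.hx a b).const_sub 1
    have := (((d.add (d.pow 2)).const_mul M).sub ((sy.hx a b).const_mul M)).add (sx.hx a b)
    refine this.congr_deriv ?_
    push_cast; ring
  have Fy : ∀ a b, DY F (a, b) = M * (- DY u (a, b) - 2 * (1 - u (a, b)) * DY u (a, b))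
      - M * DY (DY u) (a, b) + DY (DX u) (a, b) := fun a b => by
    refine dy_eq sF ?_
    have d := (su.hy a b).const_sub 1
    have := (((d.add (d.pow 2)).const_mul M).sub ((sy.hy a b).const_mul M)).add (sx.hy a b)
    refine this.congr_deriv ?_
    push_cast; ring
  have Fxx : ∀ a b, DX (DX F) (a, b) = M * (- DX (DX u) (a, b) + 2 * DX u (a, b) ^ 2
      - 2 * (1 - u (a, b)) * DX (DX u) (a, b))
      - M * DX (DX (DY u)) (a, b) + DX (DX (DX u)) (a, b) := fun a b => by
    refine dx_eq sF.dx ?_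
    rw [funext fun s => Fx s b]
    have d := (su.hx a b).const_sub 1
    have := ((((sx.hx a b).neg.sub ((d.const_mul 2).mul (sx.hx a b))).const_mul M).sub
      ((sy.dx.hx a b).const_mul M)).add (sx.dx.hx a b)
    refine this.congr_deriv ?_
    ring
  have Fyy : ∀ a b, DY (DY F) (a, b) = M * (- DY (DY u) (a, b) + 2 * DY u (a, b) ^ 2
      - 2 * (1 - u (a, b)) * DY (DY u) (a, b))
      - M * DY (DY (DY u)) (a, b) + DY (DY (DX u)) (a, b) := fun a b => by
    refine dy_eq sF.dy ?_
    rw [funext fun s => Fy a s]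
    have d := (su.hy a b).const_sub 1
    have := ((((sy.hy a b).neg.sub ((d.const_mul 2).mul (sy.hy a b))).const_mul M).sub
      ((sy.dy.hy a b).const_mul M)).add (sx.dy.hy a b)
    refine this.congr_deriv ?_
    ring
  set S : Set (ℝ × ℝ) := {p | 0 ≤ p.2 ∧ p.2 ≤ η p.1} ∩ {p | 2 / 3 ≤ u p} with hS
  have cS : IsClosed S := h.isClosed_dom.inter (isClosed_le continuous_const cu)
  obtain ⟨⟨a, b⟩, hab, hm⟩ := h.attain (S := S) cS (fun p hp => hp.1) ⟨(x, y), ⟨h0, h1⟩, h2⟩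
    (fun x y => by simp [hS, h.eper, h.uper]) sF.cont
    (fun x y => by simp only [hF, h.uper, h.per_dx, h.per_dy])
  have b0 : 0 ≤ b := hab.1.1
  have b1 : b ≤ η a := hab.1.2
  have b2 : 2 / 3 ≤ u (a, b) := hab.2
  have bp := h.y_gt_one hε b0 b1 b2
  have u1 := h.u_le_one b0 b1
  suffices hs : F (a, b) ≤ 0 by
    have := hm (x, y) ⟨⟨h0, h1⟩, h2⟩
    simp only [hF] at this hs
    linarith
  rcases b1.eq_or_lt with e | b1'
  · have w := h.unic a (η a) (h.pos a).le le_rfl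
    have := hη a
    rw [e]
    simp only [hF]
    rw [h.top, h.top_dx]
    nlinarith
  rcases b2.eq_or_lt with e | b2'
  · have b13 : b ≤ 13 / 10 := by
      by_contra hc
      push Not at hc
      have := h.u_ge_of_13 hε hc.le b1
      linarith
    obtain ⟨n1, n2, -⟩ := h.near13 hε (x := a) b0 b13
    have n1' := (abs_le.1 n1).2
    simp only [hF]
    rw [← e]
    have : M * (9 / 10) ≤ M * DY u (a, b) := by gcongr; linarith
    linarith
  · exfalso
    have lm : IsLocalMax F (a, b) := by
      have o : ∀ᶠ p in nhds (a, b), 2 / 3 < u p := cu.continuousAt.eventually (lt_mem_nhds b2')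
      filter_upwards [h.open_dom (by linarith) b1', o] with q hq hq2
      exact hm q ⟨⟨hq.1.le, hq.2.le⟩, hq2.le⟩
    obtain ⟨-, -, s1, s2⟩ := sF.localMax lm
    rw [Fxx] at s1
    rw [Fyy] at s2
    have L := h.lap a b (by linarith) b1'
    obtain ⟨t1, t2⟩ := h.lap3 a b (by linarith) b1'
    have c2 : DY (DY (DX u)) (a, b) = DX (DY (DY u)) (a, b) := by rw [su.comm, su.dy.comm]
    have c3 : DY (DX (DX u)) (a, b) = DX (DX (DY u)) (a, b) := by rw [su.dx.comm, su.comm]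
    have g := h.grad_ge hε b0 b1
    rw [c3] at t2
    rw [c2] at s2
    have sum : M * (-1 + 2 * (DX u (a, b) ^ 2 + DY u (a, b) ^ 2) - 2 * (1 - u (a, b))) ≤ 0 := by
      have e1 : DY (DY u) (a, b) = 1 - DX (DX u) (a, b) := by linarith
      have e2 : DY (DY (DY u)) (a, b) = - DX (DX (DY u)) (a, b) := by linarith
      have e3 : DX (DY (DY u)) (a, b) = - DX (DX (DX u)) (a, b) := by linarith
      rw [e1, e2, e3] at s2
      linarith
    have pos : 0 < -1 + 2 * (DX u (a, b) ^ 2 + DY u (a, b) ^ 2) - 2 * (1 - u (a, b)) := by linarith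
    nlinarith

/-- The slope of the surface is `O(ε)`. -/
lemma slope (h : SWave ε r Λ u η) (hε : ε ≤ 1 / 10 ^ 12) (x : ℝ) : - deriv η x ≤ 1000 * ε := by
  have ep := h.eps_pos
  have su := h.su
  have sx := su.dx
  have sy := su.dy
  have cd : Continuous (deriv η) := h.se.continuous_deriv (by norm_num)
  have per : Function.Periodic (deriv η) (2 * Λ) := by
    intro t
    have h1 := (h.ed (t + 2 * Λ)).comp_add_const t (2 * Λ)
    have e : (fun s => η (s + 2 * Λ)) = η := funext fun s => h.eper s
    rw [e] at h1
    exact h1.unique (h.ed t)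
  have hl : (0 : ℝ) < 2 * Λ := by linarith [h.lam_pos]
  obtain ⟨a, -, hmin⟩ := (isCompact_Icc (a := (0 : ℝ)) (b := 2 * Λ)).exists_isMinOn
    ⟨0, le_rfl, hl.le⟩ cd.continuousOn
  have hmin' : ∀ t, deriv η a ≤ deriv η t := fun t => by
    obtain ⟨t', ht', e⟩ := per.exists_mem_Ico₀ hl t
    rw [e]; exact hmin (Set.Ico_subset_Icc_self ht')
  set M := - deriv η a with hM
  have hη : ∀ t, - deriv η t ≤ M := fun t => by linarith [hmin' t]
  refine (hη x).trans ?_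
  by_contra hc
  push Not at hc
  have Mp : 0 < M := by linarith
  have cmp := fun {x y : ℝ} => h.slope_cmp hε hc.le hη (x := x) (y := y)
  have ea : HasDerivAt η (-M) a := by rw [hM, neg_neg]; exact h.ed a
  have q := h.q_ge hε a
  have w0 := h.unic a (η a) (h.pos a).le le_rfl
  have va : DX u (a, η a) = M * DY u (a, η a) := h.top_dx a
  have wp : 0 < DY u (a, η a) := by
    rcases w0.eq_or_lt with e | e
    · rw [va, ← e] at q; norm_num at q
    · exact e
  -- tangential derivative of `H`
  have dH := ((sy.hcurve ea).const_mul M).sub (sx.hcurve ea)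
  have mH : IsLocalMin (fun t => M * DY u (t, η t) - DX u (t, η t)) a := by
    refine Filter.Eventually.of_forall fun t => ?_
    have w := h.unic t (η t) (h.pos t).le le_rfl
    have := hη t
    simp only
    rw [va, h.top_dx]
    nlinarith
  have z1 := mH.hasDerivAt_eq_zero dH
  -- Bernoulli
  have dB := ((sx.hcurve ea).pow 2).add ((sy.hcurve ea).pow 2)
  have dB' : HasDerivAt (fun t => 2 * (r - ε * η t)) (2 * (-(ε * (-M)))) a :=
    (((ea.const_mul ε).const_sub r).const_mul 2)
  have z2 := dB.unique (dB'.congr_of_eventuallyEq (Filter.Eventually.of_forall fun t => h.bern t))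
  -- vertical derivative
  have dV : HasDerivAt (fun t => M * ((1 - u (a, t)) + (1 - u (a, t)) ^ 2)
      - (M * DY u (a, t) - DX u (a, t))) _ (η a) :=
    (((((su.hy a (η a)).const_sub 1).add (((su.hy a (η a)).const_sub 1).pow 2)).const_mul M).sub
      (((sy.hy a (η a)).const_mul M).sub (sx.hy a (η a))))
  have e13 := h.eta_ge13 hε a
  have z3 := deriv_nonneg_of_max_left (l := 13 / 10) (by linarith) dV (fun t t0 t1 => by
    have c := cmp (x := a) (y := t) (by linarith) t1.le
      (by linarith [h.u_ge_of_13 hε t0.le t1.le])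
    simp only [h.top, va]
    linarith)
  have L := h.lapc a (η a) (h.pos a).le le_rfl
  have c1 : DY (DX u) (a, η a) = DX (DY u) (a, η a) := by rw [su.comm]
  simp only [h.top] at z3
  norm_num at z2 z3
  rw [c1] at z1 z2 z3
  rw [va] at z2
  rw [va] at q
  have e1 : DY (DY u) (a, η a) = 1 - DX (DX u) (a, η a) := by linarith
  rw [e1] at z1 z2 z3
  generalize DX (DX u) (a, η a) = A at *
  generalize DX (DY u) (a, η a) = B at *
  generalize DY u (a, η a) = w at *
  have k1 : M * B - A = M * (M * (1 - A) - B) := by linarith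
  have k2 : w * (M * (M * B - A) + (M * (1 - A) - B)) = - (ε * M) := by linarith
  have k3 : M * (1 - A) - B ≤ - (M * w) := by linarith
  rw [k1] at k2
  have k4 : w * (1 + M ^ 2) * (M * (1 - A) - B) ≤ w * (1 + M ^ 2) * (-(M * w)) := by gcongr
  have k5 : M * (w ^ 2 * (1 + M ^ 2)) ≤ M * ε := by linarith
  have k6 := le_of_mul_le_mul_left k5 Mp
  linarith

lemma v_le_w (h : SWave ε r Λ u η) (hε : ε ≤ 1 / 10 ^ 12) {x y : ℝ} (h0 : 0 ≤ y) (h1 : y ≤ η x)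
    (h2 : 2 / 3 ≤ u (x, y)) : |DX u (x, y)| ≤ 1000 * ε * DY u (x, y) := by
  have ep := h.eps_pos
  have key : ∀ t, y ≤ η t → 2 / 3 ≤ u (t, y) → DX u (t, y) ≤ 1000 * ε * DY u (t, y) := by
    intro t t1 t2
    have := h.slope_cmp hε le_rfl (h.slope hε) h0 t1 t2
    have u1 := h.u_le_one h0 t1
    have : 0 ≤ 1000 * ε * ((1 - u (t, y)) + (1 - u (t, y)) ^ 2) := by
      have : 0 ≤ 1 - u (t, y) := by linarith
      positivity
    linarith
  rw [abs_le]
  constructor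
  · have := key (-x) (by rw [h.eeven]; exact h1) (by rw [h.ueven]; exact h2)
    rw [h.even_dx, h.even_dy] at this
    linarith
  · exact key x h1 h2

lemma eta_upper (h : SWave ε r Λ u η) (hε : ε ≤ 1 / 10 ^ 12) (x : ℝ) : η x ≤ √2 + 1000 * ε := by
  have ep := h.eps_pos
  have c := h.su.cont
  have e13 := h.eta_ge13 hε x
  have hpos : ∀ t ∈ Set.Icc (13 / 10) (η x), 0 < 2 * u (x, t) - 10 * ε := by
    intro t ht
    have := h.u_ge_of_13 hε ht.1 ht.2
    linarith
  have hd : ∀ t ∈ Set.Icc (13 / 10) (η x),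
      HasDerivAt (fun t => (1 + 1000 * ε) * √(2 * u (x, t) - 10 * ε) - t)
      ((1 + 1000 * ε) * ((2 * DY u (x, t)) / (2 * √(2 * u (x, t) - 10 * ε))) - 1) t := by
    intro t ht
    exact ((((((h.su.hy x t).const_mul 2).sub_const (10 * ε)).sqrt (hpos t ht).ne').const_mul
      (1 + 1000 * ε)).sub (hasDerivAt_id t))
  have hm : MonotoneOn (fun t => (1 + 1000 * ε) * √(2 * u (x, t) - 10 * ε) - t)
      (Set.Icc (13 / 10) (η x)) := by
    refine monotoneOn_of_deriv_nonneg (convex_Icc _ _) (by fun_prop) ?_ ?_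
    · intro t ht
      exact (hd t (interior_subset ht)).differentiableAt.differentiableWithinAt
    · intro t ht
      have ht' := interior_subset ht
      rw [(hd t ht').deriv]
      have t0 : 0 ≤ t := le_trans (by norm_num) ht'.1
      have p1 := hpos t ht'
      have p2 := h.grad_ge hε t0 ht'.2
      have p3 := h.v_le_w hε t0 ht'.2 (by linarith [h.u_ge_of_13 hε ht'.1 ht'.2])
      have w0 := h.unic x t t0 ht'.2
      have p4 : DX u (x, t) ^ 2 ≤ (1000 * ε * DY u (x, t)) ^ 2 := by
        rw [← sq_abs]; gcongr
      have p5 : √(2 * u (x, t) - 10 * ε) ≤ (1 + 1000 * ε) * DY u (x, t) := by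
        apply Real.sqrt_le_iff.2
        constructor
        · positivity
        · have : 0 ≤ ε * DY u (x, t) ^ 2 := by positivity
          nlinarith
      have p6 : 0 < √(2 * u (x, t) - 10 * ε) := Real.sqrt_pos.2 p1
      have e : (1 + 1000 * ε) * ((2 * DY u (x, t)) / (2 * √(2 * u (x, t) - 10 * ε))) =
          (1 + 1000 * ε) * DY u (x, t) / √(2 * u (x, t) - 10 * ε) := by field_simp
      rw [e, sub_nonneg, one_le_div p6]
      exact p5
  have key := hm ⟨le_rfl, by linarith⟩ ⟨by linarith, le_rfl⟩ (by linarith : 13 / 10 ≤ η x)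
  simp only [h.top] at key
  have k1 : √(2 * 1 - 10 * ε) ≤ √2 := Real.sqrt_le_sqrt (by linarith)
  have n := (h.near13 hε (x := x) (y := 13 / 10) (by norm_num) le_rfl).2.2
  have k2 : 13 / 10 - 500 * ε ≤ √(2 * u (x, 13 / 10) - 10 * ε) := by
    apply Real.le_sqrt_of_sq_le
    nlinarith
  have s2 : √2 ≤ 3 / 2 := Real.sqrt_le_iff.2 ⟨by norm_num, by norm_num⟩
  have k3 : (1 + 1000 * ε) * (√(2 * 1 - 10 * ε) - √(2 * u (x, 13 / 10) - 10 * ε)) ≤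
      (1 + 1000 * ε) * (√2 - (13 / 10 - 500 * ε)) := by gcongr
  nlinarith

/-- The main estimate for the rescaled problem. -/
lemma main (h : SWave ε r Λ u η) (hε : ε ≤ 1 / 10 ^ 12) (x : ℝ) :
    √2 - 4000000 * ε ^ 2 ≤ DY u (x, η x) := by
  have ep := h.eps_pos
  have s2 : 1 ≤ √2 := Real.le_sqrt_of_sq_le (by norm_num)
  have ss : √2 ^ 2 = 2 := Real.sq_sqrt (by norm_num)
  have w0 := h.unic x (η x) (h.pos x).le le_rfl
  have p3 := h.v_le_w hε (h.pos x).le le_rfl (by rw [h.top]; norm_num)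
  have p4 : DX u (x, η x) ^ 2 ≤ (1000 * ε * DY u (x, η x)) ^ 2 := by
    rw [← sq_abs]; gcongr
  have sp := h.speed (by linarith) (h.pos x).le le_rfl
  have B := h.bern x
  have eu := h.eta_upper hε x
  have lr := h.le_r
  have q1 : ε * η x ≤ ε * (√2 + 1000 * ε) := by gcongr
  have p5 : DY u (x, η x) ^ 2 ≤ 9 / 4 := by linarith [sq_nonneg (DX u (x, η x))]
  have p6 : (1000 * ε * DY u (x, η x)) ^ 2 ≤ 1000000 * ε ^ 2 * (9 / 4) := by
    have : (1000 * ε * DY u (x, η x)) ^ 2 = 1000000 * ε ^ 2 * DY u (x, η x) ^ 2 := by ring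
    rw [this]; gcongr
  have W : 2 - 4000000 * ε ^ 2 ≤ DY u (x, η x) ^ 2 := by nlinarith
  have e2 : 4000000 * ε ^ 2 ≤ 1 := by nlinarith
  apply le_of_sq_le_sq _ w0
  have : 0 ≤ 4000000 * ε ^ 2 := by positivity
  nlinarith

end SWave

/-! ### Transfer to the rescaled problem -/

lemma scale_sm {f : ℝ × ℝ → ℝ} (hf : Sm f) (k : ℝ) : Sm (fun p => f (p.1 / k, p.2 / k)) := by
  unfold Sm at *
  fun_prop

lemma scale_dx {f : ℝ × ℝ → ℝ} (hf : Sm f) (k c : ℝ) :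
    DX (fun p => f (p.1 / k, p.2 / k) / c) = fun p => DX f (p.1 / k, p.2 / k) / (c * k) := by
  funext ⟨x, y⟩
  refine dx_eq (u := fun p => f (p.1 / k, p.2 / k) / c) ?_ ?_
  · have := scale_sm hf k
    unfold Sm at *
    fun_prop
  · have := ((hf.hx (x / k) (y / k)).scomp x ((hasDerivAt_id x).div_const k)).div_const c
    refine this.congr_deriv ?_
    simp only [smul_eq_mul]
    rw [one_div_mul_eq_div, div_div, mul_comm k c]

lemma scale_dy {f : ℝ × ℝ → ℝ} (hf : Sm f) (k c : ℝ) :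
    DY (fun p => f (p.1 / k, p.2 / k) / c) = fun p => DY f (p.1 / k, p.2 / k) / (c * k) := by
  funext ⟨x, y⟩
  refine dy_eq (u := fun p => f (p.1 / k, p.2 / k) / c) ?_ ?_
  · have := scale_sm hf k
    unfold Sm at *
    fun_prop
  · have := ((hf.hy (x / k) (y / k)).scomp y ((hasDerivAt_id y).div_const k)).div_const c
    refine this.congr_deriv ?_
    simp only [smul_eq_mul]
    rw [one_div_mul_eq_div, div_div, mul_comm k c]

lemma transfer {γ r Λ sc k : ℝ} {ψ : ℝ → ℝ → ℝ} {η : ℝ → ℝ} (kp : 0 < k) (hk : k ^ 2 = γ)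
    (hw : StokesWave γ ψ η r Λ) (hu : Unidirectional ψ η) (hc : IsCrit γ sc)
    (hr : bernR γ sc < r) (hr' : r ≤ bernR γ 0) :
    SWave (1 / k ^ 3) (r / k ^ 2) (k * Λ) (fun p => ψ (p.1 / k) (p.2 / k) / 1)
      (fun x => k * η (x / k)) ∧
    ∀ x, DY (fun p => ψ (p.1 / k) (p.2 / k) / 1) (k * x, k * η x) = py ψ x (η x) / k := by
  have γp : 0 < γ := by rw [← hk]; positivity
  have sq2 : √(2 * γ) = √2 * k := by
    rw [Real.sqrt_mul (by norm_num), ← hk, Real.sqrt_sq kp.le]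
  set Ψ : ℝ × ℝ → ℝ := fun p => ψ p.1 p.2 with hΨ
  have sΨ : Sm Ψ := hw.sol.psi_smooth
  have ex : ∀ x y, px ψ x y = DX Ψ (x, y) := fun x y => (sΨ.hx x y).deriv
  have ey : ∀ x y, py ψ x y = DY Ψ (x, y) := fun x y => (sΨ.hy x y).deriv
  have exx : ∀ x y, pxx ψ x y = DX (DX Ψ) (x, y) := fun x y => by
    unfold pxx; simp only [ex]; exact (sΨ.dx.hx x y).deriv
  have eyy : ∀ x y, pyy ψ x y = DY (DY Ψ) (x, y) := fun x y => by
    unfold pyy; simp only [ey]; exact (sΨ.dy.hy x y).deriv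
  have dx1 := scale_dx sΨ k 1
  have dy1 := scale_dy sΨ k 1
  have dx2 := scale_dx sΨ.dx k (1 * k)
  have dy2 := scale_dy sΨ.dy k (1 * k)
  have ss : Sm (fun p => Ψ (p.1 / k, p.2 / k) / 1) := by
    simpa using scale_sm sΨ k
  have lt_iff : ∀ x y, y < k * η (x / k) → y / k < η (x / k) := fun x y hy => by
    rw [div_lt_iff₀ kp]; linarith
  have ck : ∀ x, k * x / k = x := fun x => by field_simp
  have crit : sc ≤ 1 / γ := by
    obtain ⟨c0, c1⟩ := hc
    have : 0 ≤ sc / (γ * √(sc ^ 2 + 2 * γ)) := by positivity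
    linarith
  refine ⟨?_, ?_⟩
  · change SWave (1 / k ^ 3) (r / k ^ 2) (k * Λ) (fun p => Ψ (p.1 / k, p.2 / k) / 1)
      (fun x => k * η (x / k))
    refine { eps_pos := by positivity, r_le := ?_, le_r := ?_, lam_pos := mul_pos kp hw.lam_pos,
             su := ss, se := ?_, pos := fun x => mul_pos kp (hw.sol.eta_pos _), lap := ?_,
             bern := ?_, top := ?_, bot := ?_, eper := ?_, eeven := ?_, uper := ?_, ueven := ?_,
             anti := ?_, uni := ?_ }
    · unfold bernR lamDepth at hr'
      norm_num at hr'
      have sk : √γ = k := by rw [← hk, Real.sqrt_sq kp.le]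
      rw [sk, ← hk] at hr'
      rw [div_le_iff₀ (by positivity)]
      have e : (1 + √2 * (1 / k ^ 3)) * k ^ 2 = k ^ 2 + √2 * k / k ^ 2 := by field_simp
      linarith
    · unfold bernR lamDepth at hr
      have a1 : √(2 * γ) ≤ √(sc ^ 2 + 2 * γ) := Real.sqrt_le_sqrt (by nlinarith)
      have a2 : (-(1 / γ) + √(2 * γ)) / γ ≤ (-sc + √(sc ^ 2 + 2 * γ)) / γ := by gcongr
      rw [sq2, ← hk] at a2
      rw [← hk] at hr
      rw [le_div_iff₀ (by positivity)]
      have e : (1 + √2 * (1 / k ^ 3) - (1 / k ^ 3) ^ 2) * k ^ 2 =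
          k ^ 2 + (-(1 / k ^ 2) + √2 * k) / k ^ 2 := by field_simp; ring
      rw [e]
      nlinarith [sq_nonneg sc]
    · have := hw.sol.eta_smooth
      fun_prop
    · intro x y y0 y1
      rw [dx1, dy1, dx2, dy2]
      simp only
      have := hw.sol.laplace (x / k) (y / k) (by positivity) (lt_iff x y y1)
      rw [exx, eyy] at this
      rw [← add_div, this, ← hk]
      field_simp
    · intro x
      rw [dx1, dy1]
      simp only [ck]
      have := hw.sol.bernoulli (x / k)
      rw [ex, ey] at this
      have e : r = DX Ψ (x / k, η (x / k)) ^ 2 / 2 + DY Ψ (x / k, η (x / k)) ^ 2 / 2 + η (x / k) :=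
        this.symm
      rw [e]
      field_simp
      ring
    · intro x
      simp only [ck, hΨ, hw.sol.surface_val]
      norm_num
    · intro x
      simp only [hΨ, zero_div, hw.sol.bottom_val]
    · intro x
      have : (x + 2 * (k * Λ)) / k = x / k + 2 * Λ := by field_simp
      rw [this, hw.eta_periodic]
    · intro x
      rw [neg_div, hw.eta_even]
    · intro x y
      have : (x + 2 * (k * Λ)) / k = x / k + 2 * Λ := by field_simp
      simp only [hΨ, this, hw.psi_periodic]
    · intro x y
      simp only [hΨ, neg_div, hw.psi_even]
    · intro a ha b hb hab
      have m : ∀ t ∈ Set.Icc 0 (k * Λ), t / k ∈ Set.Icc 0 Λ := fun t ht =>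
        ⟨div_nonneg ht.1 kp.le, by rw [div_le_iff₀ kp]; linarith [ht.2]⟩
      have := hw.eta_anti (m a ha) (m b hb) (by gcongr)
      exact mul_lt_mul_of_pos_left this kp
    · intro x y y0 y1
      rw [dy1]
      simp only
      have := hu (x / k) (y / k) (by positivity) (lt_iff x y y1)
      rw [ey] at this
      positivity
  · intro x
    change DY (fun p => Ψ (p.1 / k, p.2 / k) / 1) (k * x, k * η x) = _
    rw [dy1, ey]
    simp only [ck, one_mul]

/-- Theorem 1.1 (i): for large adverse vorticity `γ`, every unidirectional Stokes wave
with `R(s_c) < r ≤ R(0)` satisfies `ψ_y ≥ γ η̌ - C γ⁻² ≥ √(2γ) - C γ⁻¹` on the surface. -/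
theorem surface_no_stagnation :
    ∃ C > (0 : ℝ), ∃ γ₀ > (0 : ℝ), ∀ γ > γ₀,
      ∀ (ψ : ℝ → ℝ → ℝ) (η : ℝ → ℝ) (r Λ sc : ℝ),
        StokesWave γ ψ η r Λ → Unidirectional ψ η → IsCrit γ sc →
        bernR γ sc < r → r ≤ bernR γ 0 →
        ∀ x : ℝ,
          py ψ x (η x) ≥ γ * η Λ - C / γ ^ 2 ∧
          γ * η Λ - C / γ ^ 2 ≥ Real.sqrt (2 * γ) - C / γ := by
  refine ⟨4000000, by norm_num, 10 ^ 8, by norm_num, ?_⟩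
  intro γ hγ ψ η r Λ sc hw hu hc hr hr' x
  have γp : 0 < γ := lt_trans (by norm_num) hγ
  set k := √γ with hk
  have kp : 0 < k := Real.sqrt_pos.2 γp
  have k2 : k ^ 2 = γ := Real.sq_sqrt γp.le
  have sq2 : √(2 * γ) = √2 * k := by
    rw [Real.sqrt_mul (by norm_num)]
  have kbig : 10 ^ 4 ≤ k := Real.le_sqrt_of_sq_le (by linarith)
  obtain ⟨S, D⟩ := transfer kp k2 hw hu hc hr hr'
  have hε : 1 / k ^ 3 ≤ 1 / 10 ^ 12 := by
    apply one_div_le_one_div_of_le (by norm_num)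
    calc (10 : ℝ) ^ 12 = (10 ^ 4) ^ 3 := by norm_num
      _ ≤ k ^ 3 := by gcongr
  have ck : ∀ x, k * x / k = x := fun x => by field_simp
  have m := S.main hε (k * x)
  simp only [ck] at m
  rw [D x, le_div_iff₀ kp] at m
  have tl := S.trough_le
  have tg := S.trough_ge
  simp only [ck] at tl tg
  have i1 : γ * η Λ ≤ √2 * k := by rw [← k2]; nlinarith
  have i2 : √2 * k - 2 / γ ≤ γ * η Λ := by
    have : k * (√2 - 2 * (1 / k ^ 3)) ≤ k * (k * η Λ) := by gcongr
    have e : k * (√2 - 2 * (1 / k ^ 3)) = √2 * k - 2 / k ^ 2 := by field_simp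
    rw [e] at this
    rw [← k2]
    linarith
  constructor
  · have e : (√2 - 4000000 * (1 / k ^ 3) ^ 2) * k = √2 * k - 4000000 / (k ^ 5) := by
      field_simp
    rw [e] at m
    have : 4000000 / k ^ 5 ≤ 4000000 / γ ^ 2 := by
      rw [← k2]
      apply div_le_div_of_nonneg_left (by norm_num) (by positivity)
      rw [← pow_mul]
      exact pow_le_pow_right₀ (by linarith) (by norm_num)
    linarith
  · rw [sq2]
    have : 4000000 / γ ^ 2 ≤ 4000000 / γ - 2 / γ := by
      rw [← sub_div, div_le_div_iff₀ (by positivity) γp]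
      nlinarith
    linarith
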